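/- arXiv:1310.3112 — 6 statements merged into one kernel-verified Lean document; each statement's English description precedes it below -/
import Mathlib

section
/- Let a > 0, ζ > 0, and let f be integrable and nonnegative on (0,∞). Define h(σ) := ∫_σ^∞ f(τ) e^{−(2/3)aτ} dτ. Suppose there exists σ₀ > 0 such that f(σ) > (2a(1+ζ)/3) ∫_σ^∞ f(τ) e^{−(2/3)a(τ−σ)} dτ for almost every σ ∈ (σ₀,∞). Then e^{(2/3)aσ} h(σ) < e^{−(2/3)aζσ} · e^{(2/3)a(1+ζ)σ₀} h(σ₀) for all σ > σ₀; in particular ∫_σ^∞ f(τ) e^{−(2/3)a(τ−σ)} dτ → 0 as σ → ∞. -/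
open MeasureTheory Set

/-- A discrete Gronwall step `h t * (1 + k * (t - s)) ≤ h s` integrates to exponential decay. -/
lemma mul_exp_le_of_mul_one_add_le {h : ℝ → ℝ} {k σ₀ : ℝ} (hk : 0 ≤ k)
    (hstep : ∀ s t, σ₀ ≤ s → s ≤ t → h t * (1 + k * (t - s)) ≤ h s)
    {s t : ℝ} (hs : σ₀ ≤ s) (hst : s ≤ t) : h t * Real.exp (k * (t - s)) ≤ h s := by
  have iter : ∀ (n : ℕ) (d : ℝ), 0 ≤ d → h (s + n * d) * (1 + k * d) ^ n ≤ h s := by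
    intro n d hd
    induction n with
    | zero => simp
    | succ n ih =>
      refine le_trans ?_ ih
      have h1 := hstep (s + n * d) (s + (n + 1 : ℕ) * d)
        (by have : 0 ≤ (n : ℝ) * d := by positivity
            linarith) (by push_cast; linarith)
      have h2 : s + (n + 1 : ℕ) * d - (s + n * d) = d := by push_cast; ring
      rw [h2] at h1
      have h3 : 0 ≤ (1 + k * d) ^ n := by positivity
      calc _ = h (s + (n + 1 : ℕ) * d) * (1 + k * d) * (1 + k * d) ^ n := by ring
        _ ≤ _ := mul_le_mul_of_nonneg_right h1 h3
  have lim := (Real.tendsto_one_add_div_pow_exp (k * (t - s))).const_mul (h t)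
  refine le_of_tendsto lim ?_
  filter_upwards [Filter.eventually_gt_atTop 0] with n hn
  have hn' : (n : ℝ) ≠ 0 := by positivity
  have := iter n ((t - s) / n) (div_nonneg (by linarith) (by positivity))
  rwa [show s + (n : ℝ) * ((t - s) / n) = t by field_simp; ring, ← mul_div_assoc] at this

/-- If a nonnegative `g` dominates `k` times its own tail integral almost everywhere, then the tail
integral decays strictly faster than `exp (-k * t)`. -/
lemma tail_integral_mul_exp_lt {g h : ℝ → ℝ} {k σ₀ : ℝ} (hk : 0 < k)
    (hg : IntegrableOn g (Ioi σ₀)) (hg0 : ∀ t ∈ Ioi σ₀, 0 ≤ g t)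
    (hh : ∀ t, h t = ∫ τ in Ioi t, g τ)
    (hyp : ∀ᵐ t ∂(volume.restrict (Ioi σ₀)), k * h t < g t)
    {s t : ℝ} (hs : σ₀ ≤ s) (hst : s < t) : h t * Real.exp (k * (t - s)) < h s := by
  have hgi : ∀ x, σ₀ ≤ x → IntegrableOn g (Ioi x) := fun x hx =>
    hg.mono_set (Ioi_subset_Ioi hx)
  have hgii : ∀ x y, σ₀ ≤ x → x ≤ y → IntervalIntegrable g volume x y := fun x y hx hxy =>
    (intervalIntegrable_iff_integrableOn_Ioc_of_le hxy).2 ((hgi x hx).mono_set Ioc_subset_Ioi_self)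
  have hsub : ∀ x y, σ₀ ≤ x → x ≤ y → h x - h y = ∫ τ in x..y, g τ := by
    intro x y hx hxy
    rw [hh, hh, ← intervalIntegral.integral_Ioi_sub_Ioi (hgi x hx) hxy]
  have hanti : ∀ x y, σ₀ ≤ x → x ≤ y → h y ≤ h x := by
    intro x y hx hxy
    have : 0 ≤ ∫ τ in x..y, g τ := by
      rw [intervalIntegral.integral_of_le hxy]
      exact setIntegral_nonneg measurableSet_Ioc fun τ hτ => hg0 τ (lt_of_le_of_lt hx hτ.1)
    linarith [hsub x y hx hxy]
  have hhii : ∀ x y, σ₀ ≤ x → x ≤ y → IntervalIntegrable h volume x y := by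
    intro x y hx hxy
    refine AntitoneOn.intervalIntegrable ?_
    rw [uIcc_of_le hxy]
    exact fun u hu v _ huv => hanti u v (hx.trans hu.1) huv
  have hlt : ∀ x y, σ₀ ≤ x → x < y → k * ∫ τ in x..y, h τ < h x - h y := by
    intro x y hx hxy
    have hae : ∀ᵐ τ ∂(volume.restrict (Ioc x y)), k * h τ < g τ :=
      ae_restrict_of_ae_restrict_of_subset
        (Ioc_subset_Ioi_self.trans (Ioi_subset_Ioi hx)) hyp
    rw [hsub x y hx hxy.le, ← intervalIntegral.integral_const_mul]
    refine intervalIntegral.integral_lt_integral_of_ae_le_of_measure_setOfPred_lt_ne_zero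
      hxy.le ((hhii x y hx hxy.le).const_mul k) (hgii x y hx hxy.le) (hae.mono fun _ => le_of_lt) ?_
    rw [measure_eq_measure_of_null_sdiff (subset_univ _) (by
      rw [← compl_eq_univ_sdiff]; exact hae)]
    simpa using hxy
  have hstep : ∀ x y, σ₀ ≤ x → x ≤ y → h y * (1 + k * (y - x)) ≤ h x := by
    intro x y hx hxy
    rcases hxy.eq_or_lt with rfl | hxy'
    · simp
    have h1 : ∫ _τ in x..y, h y ≤ ∫ τ in x..y, h τ :=
      intervalIntegral.integral_mono_on hxy intervalIntegrable_const (hhii x y hx hxy)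
        fun τ hτ => hanti τ y (hx.trans hτ.1) hτ.2
    rw [intervalIntegral.integral_const, smul_eq_mul] at h1
    nlinarith [hlt x y hx hxy', mul_le_mul_of_nonneg_left h1 hk.le]
  have hprim : ∫ τ in s..t, k * (h t * Real.exp (k * (t - τ))) =
      h t * Real.exp (k * (t - s)) - h t := by
    rw [intervalIntegral.integral_eq_sub_of_hasDerivAt
      (f := fun τ => -(h t * Real.exp (k * (t - τ))))]
    · simp; ring
    · intro τ _
      have h1 := ((((hasDerivAt_id τ).const_sub t).const_mul k).exp.const_mul (h t)).neg
      refine h1.congr_deriv ?_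
      simp; ring
    · exact Continuous.intervalIntegrable (by fun_prop) _ _
  have hle : ∫ τ in s..t, k * (h t * Real.exp (k * (t - τ))) ≤ ∫ τ in s..t, k * h τ :=
    intervalIntegral.integral_mono_on hst.le
      (Continuous.intervalIntegrable (by fun_prop) _ _) ((hhii s t hs hst.le).const_mul k)
      fun τ hτ => mul_le_mul_of_nonneg_left
        (mul_exp_le_of_mul_one_add_le hk.le hstep (hs.trans hτ.1) hτ.2) hk.le
  rw [hprim, intervalIntegral.integral_const_mul] at hle
  linarith [hlt s t hs hst]

/-- If `f` is integrable and nonnegative on `(0,∞)`, `h(σ) = ∫_σ^∞ f(τ) e^{-(2/3)aτ} dτ`,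
and `f(σ) > (2a(1+ζ)/3) ∫_σ^∞ f(τ) e^{-(2/3)a(τ-σ)} dτ` for a.e. `σ > σ₀`, then
`e^{(2/3)aσ} h(σ) < e^{-(2/3)aζσ} e^{(2/3)a(1+ζ)σ₀} h(σ₀)` for all `σ > σ₀`; in particular
the weighted tail integrals tend to `0` as `σ → ∞`. -/
theorem stmt_3 (a ζ : ℝ) (ha : 0 < a) (hζ : 0 < ζ)
    (f : ℝ → ℝ) (hf_int : IntegrableOn f (Ioi 0))
    (hf_nonneg : ∀ σ ∈ Ioi (0 : ℝ), 0 ≤ f σ)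
    (h : ℝ → ℝ)
    (hh : ∀ σ : ℝ, h σ = ∫ τ in Ioi σ, f τ * Real.exp (-(2 / 3) * a * τ))
    (σ₀ : ℝ) (hσ₀ : 0 < σ₀)
    (hyp : ∀ᵐ σ ∂(volume.restrict (Ioi σ₀)),
      (2 * a * (1 + ζ) / 3) *
          (∫ τ in Ioi σ, f τ * Real.exp (-(2 / 3) * a * (τ - σ))) < f σ) :
    (∀ σ > σ₀, Real.exp ((2 / 3) * a * σ) * h σ <
      Real.exp (-(2 / 3) * a * ζ * σ) *
        (Real.exp ((2 / 3) * a * (1 + ζ) * σ₀) * h σ₀)) ∧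
    Filter.Tendsto (fun σ : ℝ => ∫ τ in Ioi σ, f τ * Real.exp (-(2 / 3) * a * (τ - σ)))
      Filter.atTop (nhds 0) := by
  have hk : 0 < 2 * a * (1 + ζ) / 3 := by positivity
  have hgint : IntegrableOn (fun τ => f τ * Real.exp (-(2 / 3) * a * τ)) (Ioi σ₀) := by
    refine (hf_int.mono_set (Ioi_subset_Ioi hσ₀.le)).mul_bdd (c := 1)
      (by fun_prop) ((ae_restrict_mem measurableSet_Ioi).mono fun τ hτ => ?_)
    have hτ0 : 0 < τ := hσ₀.trans hτ
    rw [Real.norm_eq_abs, Real.abs_exp, Real.exp_le_one_iff]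
    nlinarith [mul_pos ha hτ0]
  have htail : ∀ σ : ℝ, ∫ τ in Ioi σ, f τ * Real.exp (-(2 / 3) * a * (τ - σ)) =
      Real.exp ((2 / 3) * a * σ) * h σ := by
    intro σ
    rw [hh, ← integral_const_mul]
    congr 1 with τ
    rw [show -(2 / 3) * a * (τ - σ) = (2 / 3) * a * σ + -(2 / 3) * a * τ by ring, Real.exp_add]
    ring
  have hyp' : ∀ᵐ σ ∂(volume.restrict (Ioi σ₀)),
      2 * a * (1 + ζ) / 3 * h σ < f σ * Real.exp (-(2 / 3) * a * σ) := by
    filter_upwards [hyp] with σ hσ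
    rw [htail] at hσ
    have h1 := mul_lt_mul_of_pos_right hσ (Real.exp_pos (-(2 / 3) * a * σ))
    have h2 : Real.exp ((2 / 3) * a * σ) * Real.exp (-(2 / 3) * a * σ) = 1 := by
      rw [← Real.exp_add, ← Real.exp_zero]; ring_nf
    linear_combination h1 - (2 * a * (1 + ζ) / 3 * h σ) * h2
  have main : ∀ σ > σ₀, Real.exp ((2 / 3) * a * σ) * h σ <
      Real.exp (-(2 / 3) * a * ζ * σ) *
        (Real.exp ((2 / 3) * a * (1 + ζ) * σ₀) * h σ₀) := by
    intro σ hσ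
    have h1 := tail_integral_mul_exp_lt hk hgint
      (fun τ hτ => mul_nonneg (hf_nonneg τ (hσ₀.trans hτ)) (Real.exp_pos _).le) hh hyp' le_rfl hσ
    have h2 := mul_lt_mul_of_pos_left h1
      (Real.exp_pos (-(2 / 3) * a * ζ * σ + (2 / 3) * a * (1 + ζ) * σ₀))
    calc _ = Real.exp (-(2 / 3) * a * ζ * σ + (2 / 3) * a * (1 + ζ) * σ₀) *
          (h σ * Real.exp (2 * a * (1 + ζ) / 3 * (σ - σ₀))) := by
          rw [mul_left_comm, ← Real.exp_add, mul_comm]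
          ring_nf
      _ < _ := h2
      _ = _ := by rw [Real.exp_add, mul_assoc]
  refine ⟨main, ?_⟩
  simp_rw [htail]
  have hexp : Filter.Tendsto (fun σ : ℝ => Real.exp (-(2 / 3) * a * ζ * σ))
      Filter.atTop (nhds 0) :=
    Real.tendsto_exp_atBot.comp
      (Filter.tendsto_id.const_mul_atTop_of_neg (by nlinarith [mul_pos ha hζ]))
  have hlim := hexp.mul_const (Real.exp ((2 / 3) * a * (1 + ζ) * σ₀) * h σ₀)
  rw [zero_mul] at hlim
  refine tendsto_of_tendsto_of_tendsto_of_le_of_le' tendsto_const_nhds hlim ?_ ?_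
  · filter_upwards [Filter.eventually_gt_atTop σ₀] with σ hσ
    rw [hh]
    exact mul_nonneg (Real.exp_pos _).le (setIntegral_nonneg measurableSet_Ioi fun τ hτ =>
      mul_nonneg (hf_nonneg τ (hσ₀.trans (lt_trans hσ hτ))) (Real.exp_pos _).le)
  · filter_upwards [Filter.eventually_gt_atTop σ₀] with σ hσ
    exact (main σ hσ).le
end

section
/- Let x₀ ∈ ℝ³, t₀ ∈ ℝ, a > 0, ρ > 0, and set θ(t) := √(a(t₀−t)) for t < t₀. Let v be a measurable function on {(x,t) : t₀−ρ² < t < t₀, θ(t) < |x−x₀| < √a·ρ} with values in ℝ³ satisfying ∫_{t₀−ρ²}^{t₀} ( ∫_{θ(t) < |x−x₀| < √a·ρ} |v(x,t)|^s dx )^{r/s} dt < ∞ for some r, s with 3 ≤ r < ∞, 3 < s < ∞, 2/r + 3/s = 1. Define v̄(x̄, t̄) := θ(t)·v(x₀ + θ(t)x̄, t) where t := t₀ − ρ² e^{−a t̄}, for t̄ > 0. Assume 0 < α ≤ r, 0 < β ≤ s, R > 1, and at least one of the two conditions (a) α = r and ω ≥ 0, (b) α < r and ω > 0. Then ∫_{t̄_δ}^∞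 ( ∫_{1 < |x̄| < R} |v̄(x̄,t̄)|^β dx̄ )^{α/β} e^{−ωa(t̄ − t̄_δ)} dt̄ → 0 as t̄_δ → ∞. -/
open MeasureTheory Set
open scoped ENNReal

noncomputable section

/-- ℝ³ as a Euclidean space. -/
abbrev E3 := EuclideanSpace ℝ (Fin 3)

/-- Hölder's inequality on a finite measure space, raised to the power `α`. -/
lemma lintegral_norm_rpow_rpow_le {X E : Type*} [MeasurableSpace X] [NormedAddCommGroup E]
    {μ : Measure X} {f : X → E} (hf : AEStronglyMeasurable f μ) {α β s : ℝ} (hα : 0 < α)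
    (hβ : 0 < β) (hβs : β ≤ s) :
    (∫⁻ x, ENNReal.ofReal (‖f x‖ ^ β) ∂μ) ^ (α / β) ≤
      μ univ ^ ((1 / β - 1 / s) * α) * (∫⁻ x, ENNReal.ofReal (‖f x‖ ^ s) ∂μ) ^ (α / s) := by
  have hs : 0 < s := hβ.trans_le hβs
  have enorm_rpow {p : ℝ} (hp : 0 < p) (x : X) : ENNReal.ofReal (‖f x‖ ^ p) = ‖f x‖ₑ ^ p := by
    rw [← ENNReal.ofReal_rpow_of_nonneg (norm_nonneg _) hp.le, ofReal_norm]
  have h := ENNReal.rpow_le_rpow (eLpNorm'_le_eLpNorm'_mul_rpow_measure_univ hβ hβs hf) hα.le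
  rw [ENNReal.mul_rpow_of_nonneg _ _ hα.le, eLpNorm'_eq_lintegral_enorm,
    eLpNorm'_eq_lintegral_enorm, ← ENNReal.rpow_mul, ← ENNReal.rpow_mul, ← ENNReal.rpow_mul,
    one_div_mul_eq_div, one_div_mul_eq_div, mul_comm] at h
  simpa only [enorm_rpow hβ, enorm_rpow hs] using h

/-- The integral over a half-line of an exponential decaying from the endpoint is finite and
does not depend on the endpoint. -/
lemma setLIntegral_Ioi_exp_neg_mul_sub {b : ℝ} (hb : 0 < b) (T : ℝ) :
    ∫⁻ t in Ioi T, ENNReal.ofReal (Real.exp (-b * (t - T))) = ENNReal.ofReal (1 / b) := by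
  have h (t : ℝ) : Real.exp (-b * (t - T)) = Real.exp (b * T) * Real.exp (-b * t) := by
    rw [← Real.exp_add]; ring_nf
  simp_rw [h]
  rw [← ofReal_integral_eq_lintegral_ofReal
      ((integrableOn_exp_mul_Ioi (neg_lt_zero.2 hb) T).const_mul _)
      (.of_forall fun t => by positivity),
    integral_const_mul, integral_exp_mul_Ioi (neg_lt_zero.2 hb), neg_div_neg_eq, ← mul_div_assoc,
    ← Real.exp_add]
  simp

/-- If the tails of `∫ f` vanish at infinity, so do the exponentially weighted tails of
`∫ f ^ p`. -/
lemma tendsto_setLIntegral_Ioi_rpow_mul_exp {f : ℝ → ℝ≥0∞} (hf : Measurable f)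
    (h : Filter.Tendsto (fun T => ∫⁻ t in Ioi T, f t) Filter.atTop (nhds 0))
    {p c : ℝ} (hp : 0 < p) (hpc : (p = 1 ∧ 0 ≤ c) ∨ (p < 1 ∧ 0 < c)) :
    Filter.Tendsto
      (fun T => ∫⁻ t in Ioi T, f t ^ p * ENNReal.ofReal (Real.exp (-c * (t - T))))
      Filter.atTop (nhds 0) := by
  rcases hpc with ⟨rfl, hc⟩ | ⟨hp1, hc⟩
  · refine tendsto_of_tendsto_of_tendsto_of_le_of_le tendsto_const_nhds h
      (fun _ => zero_le) fun T => ?_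
    refine setLIntegral_mono' measurableSet_Ioi fun t ht => ?_
    rw [ENNReal.rpow_one]
    refine mul_le_of_le_one_right' (ENNReal.ofReal_le_one.2 (Real.exp_le_one_iff.2 ?_))
    have : 0 < t - T := sub_pos.2 ht
    nlinarith
  · have hq : 0 < (1 - p)⁻¹ := inv_pos.2 (sub_pos.2 hp1)
    have hlim : Filter.Tendsto (fun T => (∫⁻ t in Ioi T, f t) ^ p *
        ENNReal.ofReal (1 / (c * (1 - p)⁻¹)) ^ (1 - p)) Filter.atTop (nhds 0) := by
      have := ENNReal.Tendsto.mul_const (h.ennrpow_const p)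
        (b := ENNReal.ofReal (1 / (c * (1 - p)⁻¹)) ^ (1 - p))
        (.inr (ENNReal.rpow_ne_top_of_nonneg (sub_pos.2 hp1).le ENNReal.ofReal_ne_top))
      simpa [ENNReal.zero_rpow_of_pos hp] using this
    refine tendsto_of_tendsto_of_tendsto_of_le_of_le tendsto_const_nhds hlim
      (fun _ => zero_le) fun T => ?_
    have hH := ENNReal.lintegral_mul_le_Lp_mul_Lq (volume.restrict (Ioi T))
      (Real.HolderConjugate.inv_one_sub_inv hp hp1) (hf.pow_const p).aemeasurable
      (g := fun t => ENNReal.ofReal (Real.exp (-c * (t - T)))) (by fun_prop)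
    have hexp (t : ℝ) : ENNReal.ofReal (Real.exp (-c * (t - T))) ^ (1 - p)⁻¹ =
        ENNReal.ofReal (Real.exp (-(c * (1 - p)⁻¹) * (t - T))) := by
      rw [ENNReal.ofReal_rpow_of_pos (Real.exp_pos _), ← Real.exp_mul]
      ring_nf
    simpa only [hexp, setLIntegral_Ioi_exp_neg_mul_sub (mul_pos hc hq), ← ENNReal.rpow_mul,
      mul_inv_cancel₀ hp.ne', ENNReal.rpow_one, one_div, inv_inv, Pi.mul_apply] using hH

/-- The integral over `ℝ³` of a rescaled and translated function. -/
lemma lintegral_comp_add_smul {f : E3 → ℝ≥0∞} (hf : Measurable f) (x₀ : E3) {θ : ℝ}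
    (hθ : 0 < θ) :
    ∫⁻ x, f (x₀ + θ • x) = ENNReal.ofReal ((θ ^ 3)⁻¹) * ∫⁻ x, f x := by
  have h := lintegral_map (μ := (volume : Measure E3)) (f := fun y => f (x₀ + y))
    (g := fun x => θ • x) (by fun_prop) (by fun_prop)
  rw [← h, Measure.map_addHaar_smul _ hθ.ne', lintegral_smul_measure,
    lintegral_add_left_eq_self, smul_eq_mul, finrank_euclideanSpace_fin,
    abs_of_pos (by positivity)]

/-- Scaling of the `L^s` integral of a function from an annulus of radii `θ` and at most `L`
to the annulus of radii `1` and `R`. -/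
lemma setLIntegral_annulus_smul_le {w : E3 → E3} (hw : Measurable w) (x₀ : E3)
    {θ R L s : ℝ} (hθ : 0 < θ) (hL : θ * R ≤ L) :
    ∫⁻ x in {x : E3 | 1 < ‖x‖ ∧ ‖x‖ < R}, ENNReal.ofReal (‖θ • w (x₀ + θ • x)‖ ^ s) ≤
      ENNReal.ofReal (θ ^ (s - 3)) *
        ∫⁻ x in {x : E3 | θ < ‖x - x₀‖ ∧ ‖x - x₀‖ < L}, ENNReal.ofReal (‖w x‖ ^ s) := by
  have hA : MeasurableSet {x : E3 | 1 < ‖x‖ ∧ ‖x‖ < R} :=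
    (measurableSet_lt measurable_const measurable_norm).inter
      (measurableSet_lt measurable_norm measurable_const)
  have hB : MeasurableSet {x : E3 | θ < ‖x - x₀‖ ∧ ‖x - x₀‖ < L} :=
    (measurableSet_lt (g := fun x : E3 => ‖x - x₀‖) measurable_const (by fun_prop)).inter
      (measurableSet_lt (f := fun x : E3 => ‖x - x₀‖) (by fun_prop) measurable_const)
  set g : E3 → ℝ≥0∞ := {x : E3 | θ < ‖x - x₀‖ ∧ ‖x - x₀‖ < L}.indicator
    fun x => ENNReal.ofReal (‖w x‖ ^ s) with hg
  have hgm : Measurable g := Measurable.indicator (by fun_prop) hB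
  calc
    _ ≤ ∫⁻ x, ENNReal.ofReal (θ ^ s) * g (x₀ + θ • x) := by
      rw [← lintegral_indicator hA]
      refine lintegral_mono (indicator_le fun x hx => ?_)
      have hx' : x₀ + θ • x ∈ {x : E3 | θ < ‖x - x₀‖ ∧ ‖x - x₀‖ < L} := by
        simp only [mem_ofPred_eq, add_sub_cancel_left, norm_smul, Real.norm_of_nonneg hθ.le]
        exact ⟨lt_mul_of_one_lt_right hθ hx.1,
          (mul_lt_mul_of_pos_left hx.2 hθ).trans_le hL⟩
      rw [hg, indicator_of_mem hx', norm_smul, Real.norm_of_nonneg hθ.le,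
        Real.mul_rpow hθ.le (norm_nonneg _), ENNReal.ofReal_mul (by positivity)]
    _ = _ := by
      rw [lintegral_const_mul _ (by fun_prop), lintegral_comp_add_smul hgm x₀ hθ, ← mul_assoc,
        ← ENNReal.ofReal_mul (by positivity), hg, lintegral_indicator hB,
        Real.rpow_sub hθ, div_eq_mul_inv]
      norm_num

/-- The tails of the integral of a function integrable near `t₀⁻`, in the exponential time
variable. -/
lemma tendsto_setLIntegral_Ioi_exp_comp {t₀ a κ : ℝ} (ha : 0 < a) (hκ : 0 < κ) {g : ℝ → ℝ≥0∞}
    (hg : ∫⁻ t in Ioo (t₀ - κ) t₀, g t ≠ ⊤) :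
    Filter.Tendsto (fun T => ∫⁻ τ in Ioi T,
        ENNReal.ofReal (a * κ * Real.exp (-a * τ)) * g (t₀ - κ * Real.exp (-a * τ)))
      Filter.atTop (nhds 0) := by
  have hexp : Filter.Tendsto (fun T : ℝ => κ * Real.exp (-a * T)) Filter.atTop (nhds 0) := by
    simpa using (Real.tendsto_exp_atBot.comp
      (Filter.tendsto_id.const_mul_atTop_of_neg (neg_lt_zero.2 ha))).const_mul κ
  have hvol : Filter.Tendsto (volume.restrict (Ioo (t₀ - κ) t₀) ∘
      fun T => Ioo (t₀ - κ * Real.exp (-a * T)) t₀) Filter.atTop (nhds 0) := by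
    refine tendsto_of_tendsto_of_tendsto_of_le_of_le tendsto_const_nhds
      (by simpa only [ENNReal.ofReal_zero] using ENNReal.tendsto_ofReal hexp) (fun _ => zero_le) fun T => ?_
    refine (Measure.restrict_apply_le _ _).trans ?_
    rw [Real.volume_Ioo, sub_sub_cancel]
  refine tendsto_of_tendsto_of_tendsto_of_le_of_le' tendsto_const_nhds
    (tendsto_setLIntegral_zero hg hvol) (.of_forall fun _ => zero_le) ?_
  filter_upwards [Filter.eventually_ge_atTop 0] with T hT
  have hder (τ : ℝ) : HasDerivAt (fun τ => t₀ - κ * Real.exp (-a * τ))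
      (a * κ * Real.exp (-a * τ)) τ := by
    have := ((((hasDerivAt_id τ).const_mul (-a)).exp).const_mul κ).const_sub t₀
    refine this.congr_deriv ?_
    simp
    ring
  have hmono : StrictMono fun τ => t₀ - κ * Real.exp (-a * τ) := fun x y hxy =>
    sub_lt_sub_left (mul_lt_mul_of_pos_left
      (Real.exp_lt_exp.2 (mul_lt_mul_of_neg_left hxy (neg_lt_zero.2 ha))) hκ) _
  have hch := lintegral_image_eq_lintegral_abs_deriv_mul (measurableSet_Ioi (a := T))
    (fun τ _ => (hder τ).hasDerivWithinAt) hmono.injective.injOn g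
  have habs (τ : ℝ) : |a * κ * Real.exp (-a * τ)| = a * κ * Real.exp (-a * τ) :=
    abs_of_pos (by positivity)
  simp only [habs] at hch
  rw [← hch, Measure.restrict_restrict measurableSet_Ioo]
  refine lintegral_mono_set ?_
  rintro _ ⟨τ, hτ, rfl⟩
  have hlt : t₀ - κ * Real.exp (-a * T) < t₀ - κ * Real.exp (-a * τ) := hmono hτ
  have hlt' : t₀ - κ * Real.exp (-a * τ) < t₀ := sub_lt_self _ (by positivity)
  have hle : κ * Real.exp (-a * T) ≤ κ :=
    mul_le_of_le_one_right hκ.le (Real.exp_le_one_iff.2 (by nlinarith))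
  exact ⟨⟨hlt, hlt'⟩, by linarith, hlt'⟩

/-- **Lemma 4 (Neustupa).** Suppose `v` satisfies the Serrin-type condition with
`2/r + 3/s = 1` in the region between the paraboloid `|x−x₀| = θ(t) = √(a(t₀−t))` and
the cylinder `|x−x₀| = √a·ρ`, and let `v̄(x̄,t̄) = θ(t)·v(x₀+θ(t)x̄,t)`,
`t = t₀ − ρ²e^{−at̄}`, be the transformed velocity. If `0 < α ≤ r`, `0 < β ≤ s`,
`R > 1` and either (`α = r` and `ω ≥ 0`) or (`α < r` and `ω > 0`), then
`∫_{t̄_δ}^∞ (∫_{1<|x̄|<R} |v̄|^β dx̄)^{α/β} e^{−ωa(t̄−t̄_δ)} dt̄ → 0` as `t̄_δ → ∞`. -/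
theorem stmt_4 (x₀ : E3) (t₀ a ρ : ℝ) (ha : 0 < a) (hρ : 0 < ρ)
    (θ : ℝ → ℝ) (hθ : ∀ t, θ t = Real.sqrt (a * (t₀ - t)))
    (v : E3 → ℝ → E3) (hv : Measurable fun q : E3 × ℝ => v q.1 q.2)
    (r s : ℝ) (hr : 3 ≤ r) (hs : 3 < s) (hrs : 2 / r + 3 / s = 1)
    (hint : (∫⁻ t in Ioo (t₀ - ρ ^ 2) t₀,
        (∫⁻ x in {x : E3 | θ t < ‖x - x₀‖ ∧ ‖x - x₀‖ < Real.sqrt a * ρ},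
          ENNReal.ofReal (‖v x t‖ ^ s)) ^ (r / s)) < ⊤)
    (vb : E3 → ℝ → E3)
    (hvb : ∀ xb tb, vb xb tb =
      θ (t₀ - ρ ^ 2 * Real.exp (-a * tb)) •
        v (x₀ + θ (t₀ - ρ ^ 2 * Real.exp (-a * tb)) • xb)
          (t₀ - ρ ^ 2 * Real.exp (-a * tb)))
    (α β R ω : ℝ) (hα0 : 0 < α) (hαr : α ≤ r) (hβ0 : 0 < β) (hβs : β ≤ s)
    (hR : 1 < R)
    (hcond : (α = r ∧ 0 ≤ ω) ∨ (α < r ∧ 0 < ω)) :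
    Filter.Tendsto (fun tdel : ℝ =>
        ∫⁻ tb in Ioi tdel,
          (∫⁻ xb in {xb : E3 | 1 < ‖xb‖ ∧ ‖xb‖ < R},
              ENNReal.ofReal (‖vb xb tb‖ ^ β)) ^ (α / β) *
            ENNReal.ofReal (Real.exp (-ω * a * (tb - tdel))))
      Filter.atTop (nhds 0) := by
  have hs0 : 0 < s := by linarith
  have hr0 : 0 < r := by linarith
  have hκ : 0 < ρ ^ 2 := by positivity
  have hvbm : Measurable fun q : E3 × ℝ => vb q.1 q.2 := by
    simp only [hvb, hθ]
    have : Measurable fun q : E3 × ℝ =>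
        v (x₀ + Real.sqrt (a * (t₀ - (t₀ - ρ ^ 2 * Real.exp (-a * q.2)))) • q.1)
          (t₀ - ρ ^ 2 * Real.exp (-a * q.2)) :=
      hv.comp (g := fun q : E3 × ℝ => v q.1 q.2)
        (f := fun q : E3 × ℝ =>
          (x₀ + Real.sqrt (a * (t₀ - (t₀ - ρ ^ 2 * Real.exp (-a * q.2)))) • q.1,
            t₀ - ρ ^ 2 * Real.exp (-a * q.2))) (by fun_prop)
    fun_prop
  set A : Set E3 := {xb : E3 | 1 < ‖xb‖ ∧ ‖xb‖ < R} with hA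
  have hAfin : volume A ≠ ⊤ := by
    refine ((measure_mono fun x hx => ?_).trans_lt
      (measure_ball_lt_top (μ := volume) (x := (0 : E3)) (r := R))).ne
    simpa using hx.2
  set F : ℝ → ℝ≥0∞ := fun τ =>
    (∫⁻ x in A, ENNReal.ofReal (‖vb x τ‖ ^ s)) ^ (r / s) with hF
  have hFm : Measurable F :=
    (Measurable.lintegral_prod_left' (μ := volume.restrict A)
      (f := fun q : E3 × ℝ => ENNReal.ofReal (‖vb q.1 q.2‖ ^ s)) (by fun_prop)).pow_const _
  have hθτ (τ : ℝ) : θ (t₀ - ρ ^ 2 * Real.exp (-a * τ)) =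
      Real.sqrt a * ρ * Real.sqrt (Real.exp (-a * τ)) := by
    rw [hθ, sub_sub_cancel, Real.sqrt_mul ha.le, Real.sqrt_mul hκ.le, Real.sqrt_sq hρ.le,
      mul_assoc]
  have hFtail : Filter.Tendsto (fun T => ∫⁻ τ in Ioi T, F τ) Filter.atTop (nhds 0) := by
    have hsmall : ∀ᶠ T : ℝ in Filter.atTop, ∀ τ ∈ Ioi T,
        Real.sqrt (Real.exp (-a * τ)) * R ≤ 1 := by
      have hlim : Filter.Tendsto (fun τ : ℝ => Real.sqrt (Real.exp (-a * τ)) * R)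
          Filter.atTop (nhds 0) := by
        have := ((Real.tendsto_exp_atBot.comp
          (Filter.tendsto_id.const_mul_atTop_of_neg (neg_lt_zero.2 ha))).sqrt).mul_const R
        simpa using this
      obtain ⟨T₀, hT₀⟩ := Filter.eventually_atTop.1 (hlim.eventually_le_const one_pos)
      filter_upwards [Filter.eventually_ge_atTop T₀] with T hT τ hτ
      exact hT₀ τ (hT.trans hτ.le)
    refine tendsto_of_tendsto_of_tendsto_of_le_of_le' tendsto_const_nhds
      (tendsto_setLIntegral_Ioi_exp_comp ha hκ hint.ne) (.of_forall fun _ => zero_le) ?_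
    filter_upwards [hsmall] with T hT
    refine setLIntegral_mono' measurableSet_Ioi fun τ hτ => ?_
    have hθ0 : 0 < θ (t₀ - ρ ^ 2 * Real.exp (-a * τ)) := by rw [hθτ]; positivity
    have hθR : θ (t₀ - ρ ^ 2 * Real.exp (-a * τ)) * R ≤ Real.sqrt a * ρ := by
      rw [hθτ, mul_assoc]
      exact mul_le_of_le_one_right (by positivity) (hT τ hτ)
    have hθsq : θ (t₀ - ρ ^ 2 * Real.exp (-a * τ)) ^ 2 = a * ρ ^ 2 * Real.exp (-a * τ) := by
      rw [hθ, sub_sub_cancel, Real.sq_sqrt (by positivity), mul_assoc]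
    have hexpo : (s - 3) * (r / s) = 2 := by
      field_simp at hrs ⊢
      linarith
    have hscale := setLIntegral_annulus_smul_le (s := s)
      (w := fun x => v x (t₀ - ρ ^ 2 * Real.exp (-a * τ))) (hv.comp measurable_prodMk_right)
      x₀ hθ0 hθR
    simp only [← hvb] at hscale
    refine (ENNReal.rpow_le_rpow hscale (by positivity)).trans_eq ?_
    rw [ENNReal.mul_rpow_of_nonneg _ _ (by positivity),
      ENNReal.ofReal_rpow_of_nonneg (by positivity) (by positivity), ← Real.rpow_mul hθ0.le,
      hexpo, Real.rpow_two, hθsq]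
  have hcond' : (α / r = 1 ∧ 0 ≤ ω * a) ∨ (α / r < 1 ∧ 0 < ω * a) := by
    rcases hcond with ⟨h, hω⟩ | ⟨h, hω⟩
    · exact .inl ⟨(div_eq_one_iff_eq hr0.ne').2 h, by positivity⟩
    · exact .inr ⟨(div_lt_one hr0).2 h, by positivity⟩
  have hK : volume A ^ ((1 / β - 1 / s) * α) ≠ ⊤ :=
    ENNReal.rpow_ne_top_of_nonneg
      (mul_nonneg (sub_nonneg.2 (one_div_le_one_div_of_le hβ0 hβs)) hα0.le) hAfin
  have hlim := ENNReal.Tendsto.const_mul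
    (tendsto_setLIntegral_Ioi_rpow_mul_exp hFm hFtail (div_pos hα0 hr0) hcond') (.inr hK)
  rw [mul_zero] at hlim
  refine tendsto_of_tendsto_of_tendsto_of_le_of_le tendsto_const_nhds hlim
    (fun _ => zero_le) fun T => ?_
  dsimp only
  rw [← lintegral_const_mul' _ _ hK]
  refine lintegral_mono fun τ => ?_
  have hH := lintegral_norm_rpow_rpow_le (μ := volume.restrict A) (f := fun x => vb x τ)
    (hvbm.comp measurable_prodMk_right).aestronglyMeasurable hα0 hβ0 hβs
  rw [Measure.restrict_apply_univ] at hH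
  have hexpo : r / s * (α / r) = α / s := by field_simp
  rw [hF, ← ENNReal.rpow_mul, hexpo, neg_mul, ← mul_assoc]
  gcongr
end
end

section
/- Let x₀ ∈ ℝ³, t₀ ∈ ℝ, a > 0, ρ > 0, θ(t) := √(a(t₀−t)), and let v be a measurable ℝ³-valued function on U := {(x,t) : t₀−ρ² < t < t₀, θ(t) < |x−x₀| < √a·ρ} satisfying ∫_{t₀−ρ²}^{t₀} ( ∫_{θ(t) < |x−x₀| < √a·ρ} |v(x,t)|^s dx )^{r/s} dt < ∞ for some r, s with 3 ≤ r < ∞, 3 < s < ∞, 2/r + 3/s = 1. Then lim_{δ→0+} (1/δ²) ∫_{t₀−δ²}^{t₀} ∫_{θ(t) < |x−x₀| < √a·δ} |v(x,t)|³ dx dt = 0. -/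
open MeasureTheory Set
open scoped ENNReal Topology

noncomputable section

open Filter

/-- Jensen's inequality for the concave power `p ≤ 1`, with the total mass of the measure. -/
lemma lintegral_rpow_le_rpow_lintegral_mul_measure {α : Type*} [MeasurableSpace α]
    {μ : Measure α} {f : α → ℝ≥0∞} (hf : AEMeasurable f μ) {p : ℝ} (hp : 0 ≤ p) (hp1 : p ≤ 1) :
    ∫⁻ x, f x ^ p ∂μ ≤ (∫⁻ x, f x ∂μ) ^ p * μ univ ^ (1 - p) := by
  have h := ENNReal.lintegral_mul_norm_pow_le hf (aemeasurable_const (b := (1 : ℝ≥0∞)))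
    hp (sub_nonneg.2 hp1) (by ring)
  simpa using h

/-- The parabolic scaling of the Hölder constants: all powers of `δ` cancel. -/
lemma parabolic_scaling_cancel {δ r : ℝ} (hδ : 0 < δ) (b : ℝ) (hr : 0 < r)
    (V : ℝ≥0∞) :
    ENNReal.ofReal (1 / δ ^ 2) * (ENNReal.ofReal (δ ^ 2) ^ (1 - 3 / r) *
      (ENNReal.ofReal ((b * δ) ^ 3) * V) ^ (2 / r)) =
    (ENNReal.ofReal (b ^ 3) * V) ^ (2 / r) := by
  have hr' : 0 ≤ 2 / r := by positivity
  have h1 : ENNReal.ofReal ((b * δ) ^ 3) * V =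
      ENNReal.ofReal (δ ^ 3) * (ENNReal.ofReal (b ^ 3) * V) := by
    rw [mul_pow, mul_comm (b ^ 3), ENNReal.ofReal_mul (by positivity), mul_assoc]
  have h2 : 1 / δ ^ 2 * ((δ ^ 2) ^ (1 - 3 / r) * (δ ^ 3) ^ (2 / r)) = 1 := by
    rw [← Real.rpow_natCast δ 2, ← Real.rpow_natCast δ 3, ← Real.rpow_mul hδ.le,
      ← Real.rpow_mul hδ.le, ← Real.rpow_add hδ, one_div, ← Real.rpow_neg hδ.le,
      ← Real.rpow_add hδ]
    convert Real.rpow_zero δ using 2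
    push_cast
    field_simp
    ring
  rw [h1, ENNReal.mul_rpow_of_nonneg _ _ hr', ENNReal.ofReal_rpow_of_pos (by positivity),
    ENNReal.ofReal_rpow_of_pos (by positivity), ← mul_assoc, ← mul_assoc,
    ← ENNReal.ofReal_mul (by positivity), ← ENNReal.ofReal_mul (by positivity),
    mul_assoc (1 / δ ^ 2), h2, ENNReal.ofReal_one, one_mul]

/-- If `v` satisfies the Serrin-type condition with `2/r + 3/s = 1` in the backward
parabolic region between the paraboloid `|x−x₀| = θ(t) = √(a(t₀−t))` and the cylinder
`|x−x₀| = √a·ρ`, then `(1/δ²) ∫_{t₀−δ²}^{t₀} ∫_{θ(t)<|x−x₀|<√a·δ} |v|³ dx dt → 0` as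
`δ → 0+`. -/
theorem stmt_6 (x₀ : E3) (t₀ a ρ : ℝ) (ha : 0 < a) (hρ : 0 < ρ)
    (θ : ℝ → ℝ) (hθ : ∀ t, θ t = Real.sqrt (a * (t₀ - t)))
    (v : E3 → ℝ → E3) (hv : Measurable fun q : E3 × ℝ => v q.1 q.2)
    (r s : ℝ) (hr : 3 ≤ r) (hs : 3 < s) (hrs : 2 / r + 3 / s = 1)
    (hint : (∫⁻ t in Ioo (t₀ - ρ ^ 2) t₀,
        (∫⁻ x in {x : E3 | θ t < ‖x - x₀‖ ∧ ‖x - x₀‖ < Real.sqrt a * ρ},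
          ENNReal.ofReal (‖v x t‖ ^ s)) ^ (r / s)) < ⊤) :
    Filter.Tendsto (fun δ : ℝ =>
        ENNReal.ofReal (1 / δ ^ 2) * ∫⁻ t in Ioo (t₀ - δ ^ 2) t₀,
          ∫⁻ x in {x : E3 | θ t < ‖x - x₀‖ ∧ ‖x - x₀‖ < Real.sqrt a * δ},
            ENNReal.ofReal (‖v x t‖ ^ 3))
      (𝓝[>] 0) (nhds 0) := by
  have hr0 : 0 < r := by linarith
  have hs0 : 0 < s := by linarith
  have hsr : 1 - 3 / s = 2 / r := by linarith
  have hθm : Measurable θ := by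
    rw [funext hθ]
    fun_prop
  let A : ℝ → ℝ → Set E3 := fun R t => {x : E3 | θ t < ‖x - x₀‖ ∧ ‖x - x₀‖ < Real.sqrt a * R}
  let g : E3 → ℝ → ℝ≥0∞ := fun x t => ENNReal.ofReal (‖v x t‖ ^ s)
  let F : ℝ → ℝ≥0∞ := fun t => (∫⁻ x in A ρ t, g x t) ^ (r / s)
  have hgm : Measurable fun q : E3 × ℝ => g q.1 q.2 :=
    (hv.norm.pow_const s).ennreal_ofReal
  have hgt (t : ℝ) : Measurable fun x => g x t := hgm.of_uncurry_right
  have hAm (R : ℝ) : MeasurableSet {q : E3 × ℝ | q.1 ∈ A R q.2} := by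
    have hn : Measurable fun q : E3 × ℝ => ‖q.1 - x₀‖ :=
      (measurable_fst.sub_const x₀).norm
    exact (measurableSet_lt (hθm.comp measurable_snd) hn).inter
      (measurableSet_lt hn measurable_const)
  have hAt (R t : ℝ) : MeasurableSet (A R t) := measurable_prodMk_right (hAm R)
  have hFm : Measurable F := by
    refine Measurable.pow_const ?_ _
    have h : Measurable fun t => ∫⁻ x, {q : E3 × ℝ | q.1 ∈ A ρ q.2}.indicator
        (fun q => g q.1 q.2) (x, t) := (hgm.indicator (hAm ρ)).lintegral_prod_left'
    convert h using 2 with t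
    rw [← lintegral_indicator (hAt ρ t)]
    rfl
  have hF0 : Tendsto (fun δ : ℝ => ∫⁻ t in Ioo (t₀ - δ ^ 2) t₀, F t) (𝓝[>] 0) (𝓝 0) := by
    have hvol : Tendsto (fun δ : ℝ =>
        (volume.restrict (Ioo (t₀ - ρ ^ 2) t₀)) (Ioo (t₀ - δ ^ 2) t₀)) (𝓝[>] 0) (𝓝 0) := by
      have hlim : Tendsto (fun δ : ℝ => ENNReal.ofReal (δ ^ 2)) (𝓝[>] 0) (𝓝 0) := by
        have hc : Continuous fun δ : ℝ => ENNReal.ofReal (δ ^ 2) :=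
          ENNReal.continuous_ofReal.comp (continuous_pow 2)
        simpa using (hc.tendsto 0).mono_left nhdsWithin_le_nhds
      refine tendsto_of_tendsto_of_tendsto_of_le_of_le tendsto_const_nhds hlim
        (fun _ => zero_le) fun δ => ?_
      refine (Measure.restrict_apply_le _ _).trans_eq ?_
      simp
    refine (tendsto_setLIntegral_zero hint.ne hvol).congr' ?_
    filter_upwards [Ioo_mem_nhdsGT hρ] with δ hδ
    rw [Measure.restrict_restrict measurableSet_Ioo, inter_eq_left.2]
    exact Ioo_subset_Ioo_left (by nlinarith [hδ.1, hδ.2])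
  let V : ℝ≥0∞ := volume (Metric.ball (0 : E3) 1)
  let K : ℝ≥0∞ := (ENNReal.ofReal (Real.sqrt a ^ 3) * V) ^ (2 / r)
  have hK : K ≠ ⊤ := ENNReal.rpow_ne_top_of_nonneg (by positivity)
    (ENNReal.mul_ne_top ENNReal.ofReal_ne_top measure_ball_lt_top.ne)
  have hlim : Tendsto (fun δ : ℝ => K * (∫⁻ t in Ioo (t₀ - δ ^ 2) t₀, F t) ^ (3 / r))
      (𝓝[>] 0) (𝓝 0) := by
    have h3 : 0 < 3 / r := by positivity
    have h := ENNReal.Tendsto.const_mul (hF0.ennrpow_const (3 / r)) (Or.inr hK)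
    rwa [ENNReal.zero_rpow_of_pos h3, mul_zero] at h
  refine tendsto_of_tendsto_of_tendsto_of_le_of_le' tendsto_const_nhds hlim
    (Eventually.of_forall fun _ => zero_le) ?_
  filter_upwards [Ioo_mem_nhdsGT hρ] with δ hδ
  let W : ℝ≥0∞ := ENNReal.ofReal ((Real.sqrt a * δ) ^ 3) * V
  have hspace (t : ℝ) :
      ∫⁻ x in A δ t, ENNReal.ofReal (‖v x t‖ ^ 3) ≤ F t ^ (3 / r) * W ^ (2 / r) := by
    have hvolA : volume (A δ t) ≤ W := by
      refine (measure_mono fun x hx => ?_ :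
        volume (A δ t) ≤ volume (Metric.ball x₀ (Real.sqrt a * δ))).trans_eq ?_
      · exact mem_ball_iff_norm.2 hx.2
      · rw [Measure.addHaar_ball _ _ (mul_nonneg (Real.sqrt_nonneg a) hδ.1.le)]
        simp [W, V]
    have hsub : A δ t ⊆ A ρ t := fun x hx =>
      ⟨hx.1, hx.2.trans_le (mul_le_mul_of_nonneg_left hδ.2.le (Real.sqrt_nonneg a))⟩
    calc ∫⁻ x in A δ t, ENNReal.ofReal (‖v x t‖ ^ 3)
        = ∫⁻ x in A δ t, g x t ^ (3 / s) := by
          refine lintegral_congr fun x => ?_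
          rw [ENNReal.ofReal_rpow_of_nonneg (by positivity) (by positivity),
            ← Real.rpow_mul (norm_nonneg _), mul_div_cancel₀ _ hs0.ne']
          norm_cast
      _ ≤ (∫⁻ x in A δ t, g x t) ^ (3 / s) * volume (A δ t) ^ (2 / r) := by
          have h := lintegral_rpow_le_rpow_lintegral_mul_measure
            (μ := volume.restrict (A δ t)) (hgt t).aemeasurable
            (p := 3 / s) (by positivity) ((div_le_one hs0).2 hs.le)
          rwa [Measure.restrict_apply_univ, hsr] at h
      _ ≤ (∫⁻ x in A ρ t, g x t) ^ (3 / s) * W ^ (2 / r) := by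
          gcongr
      _ = F t ^ (3 / r) * W ^ (2 / r) := by
          rw [← ENNReal.rpow_mul]
          congr 3
          field_simp
  calc _ ≤ ENNReal.ofReal (1 / δ ^ 2) *
        ∫⁻ t in Ioo (t₀ - δ ^ 2) t₀, F t ^ (3 / r) * W ^ (2 / r) := by
        gcongr with t
        exact hspace t
    _ = ENNReal.ofReal (1 / δ ^ 2) *
        ((∫⁻ t in Ioo (t₀ - δ ^ 2) t₀, F t ^ (3 / r)) * W ^ (2 / r)) := by
        rw [lintegral_mul_const _ (hFm.pow_const _)]
    _ ≤ ENNReal.ofReal (1 / δ ^ 2) * (((∫⁻ t in Ioo (t₀ - δ ^ 2) t₀, F t) ^ (3 / r) *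
          ENNReal.ofReal (δ ^ 2) ^ (1 - 3 / r)) * W ^ (2 / r)) := by
        have h := lintegral_rpow_le_rpow_lintegral_mul_measure
          (μ := volume.restrict (Ioo (t₀ - δ ^ 2) t₀)) hFm.aemeasurable
          (p := 3 / r) (by positivity) ((div_le_one hr0).2 hr)
        rw [Measure.restrict_apply_univ, Real.volume_Ioo, sub_sub_cancel] at h
        gcongr
    _ = K * (∫⁻ t in Ioo (t₀ - δ ^ 2) t₀, F t) ^ (3 / r) := by
        have h : ENNReal.ofReal (1 / δ ^ 2) * (ENNReal.ofReal (δ ^ 2) ^ (1 - 3 / r) *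
            W ^ (2 / r)) = K := parabolic_scaling_cancel hδ.1 (Real.sqrt a) hr0 V
        rw [← h]
        ring
end
end

section
/- Let a > 0 and σ ∈ ℝ. Let u : ℝ³ × (σ,∞) → ℝ³ be measurable and such that for almost every t̄ ∈ (σ,∞) the function u(·,t̄) is smooth with compact support in ℝ³. Then ∫_σ^∞ ( ∫_{ℝ³} |u(x̄,t̄)|³ dx̄ ) e^{−a(t̄−σ)} dt̄ ≤ (2/(3^{3/4}π)) · ( ∫_σ^∞ ‖∇u(·,t̄)‖²_{L²(ℝ³)} e^{−(2/3)a(t̄−σ)} dt̄ )^{3/4} · ( ∫_σ^∞ ‖u(·,t̄)‖⁶_{L²(ℝ³)} e^{−2a(t̄−σ)} dt̄ )^{1/4}. -/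
open MeasureTheory Set Real
open scoped ENNReal

noncomputable section

/-- The `i`-th standard basis vector of ℝ³. -/
def e3 (i : Fin 3) : E3 := EuclideanSpace.single i 1

/-- Partial derivative in the `i`-th coordinate direction. -/
def pd {F : Type*} [NormedAddCommGroup F] [NormedSpace ℝ F]
    (i : Fin 3) (f : E3 → F) (x : E3) : F :=
  fderiv ℝ f x (e3 i)

/-- Squared Frobenius norm of the gradient (Jacobian matrix) of a vector field. -/
def gradSqV (u : E3 → E3) (x : E3) : ℝ := ∑ i, ∑ j, (pd i u x j) ^ 2

/-! ### Distribution functions on an interval -/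

section Interval

variable {R : ℝ} {ρ : ℝ → ℝ}

/-- The distribution function of the density `ρ` on `[-R, R]`, rescaled to take values
in `[-1, 1]`. -/
def centeredCdf (R : ℝ) (ρ : ℝ → ℝ) (t : ℝ) : ℝ :=
  2 * (∫ s in (-R)..t, ρ s) / (∫ s in (-R)..R, ρ s) - 1

lemma hasDerivAt_centeredCdf (hρ : Continuous ρ) (t : ℝ) :
    HasDerivAt (centeredCdf R ρ) (2 * ρ t / ∫ s in (-R)..R, ρ s) t :=
  (((hρ.integral_hasStrictDerivAt (-R) t).hasDerivAt.const_mul 2).div_const _).sub_const 1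

lemma continuous_centeredCdf (hρ : Continuous ρ) : Continuous (centeredCdf R ρ) :=
  continuous_iff_continuousAt.2 fun t => (hasDerivAt_centeredCdf hρ t).continuousAt

lemma centeredCdf_left : centeredCdf R ρ (-R) = -1 := by simp [centeredCdf]

lemma centeredCdf_right (h : ∫ s in (-R)..R, ρ s ≠ 0) : centeredCdf R ρ R = 1 := by
  rw [centeredCdf, mul_div_assoc, div_self h]; norm_num

lemma lintegral_Ioc_ofReal (hR : 0 ≤ R) (hρ : Continuous ρ) (h0 : ∀ t, 0 ≤ ρ t) :
    ∫⁻ t in Ioc (-R) R, ENNReal.ofReal (ρ t) = ENNReal.ofReal (∫ t in (-R)..R, ρ t) := by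
  rw [intervalIntegral.integral_of_le (by linarith), ofReal_integral_eq_lintegral_ofReal]
  · exact hρ.integrableOn_Ioc
  · exact Filter.Eventually.of_forall h0

/-- Under the density `ρ`, `centeredCdf R ρ` is uniformly distributed on `[-1, 1]`. -/
lemma integral_mul_quartic_centeredCdf (hρ : Continuous ρ) (α β γ : ℝ) :
    ∫ t in (-R)..R, ρ t * (α * centeredCdf R ρ t ^ 4 + β * centeredCdf R ρ t ^ 2 + γ) =
      (∫ t in (-R)..R, ρ t) * (α / 5 + β / 3 + γ) := by
  by_cases hm : ∫ t in (-R)..R, ρ t = 0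
  · have : ∀ t, centeredCdf R ρ t = -1 := fun t => by simp [centeredCdf, hm]
    simp only [this, intervalIntegral.integral_mul_const, hm, zero_mul]
  · set m := ∫ t in (-R)..R, ρ t with hmdef
    have hd : ∀ t, HasDerivAt (fun t => m / 2 * (α / 5 * centeredCdf R ρ t ^ 5 +
        β / 3 * centeredCdf R ρ t ^ 3 + γ * centeredCdf R ρ t))
        (ρ t * (α * centeredCdf R ρ t ^ 4 + β * centeredCdf R ρ t ^ 2 + γ)) t := by
      intro t
      have h := hasDerivAt_centeredCdf (R := R) hρ t
      rw [← hmdef] at h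
      have := ((((h.pow 5).const_mul (α / 5)).add ((h.pow 3).const_mul (β / 3))).add
        (h.const_mul γ)).const_mul (m / 2)
      refine this.congr_deriv ?_
      push_cast
      field_simp
    have hc := continuous_centeredCdf (R := R) hρ
    rw [intervalIntegral.integral_eq_sub_of_hasDerivAt (fun t _ => hd t)
      (Continuous.intervalIntegrable (by fun_prop) _ _), centeredCdf_left,
      centeredCdf_right hm]
    ring

lemma lintegral_mul_quartic_centeredCdf (hR : 0 ≤ R) (hρ : Continuous ρ) (h0 : ∀ t, 0 ≤ ρ t)
    {α β γ : ℝ} (hα : 0 ≤ α) (hβ : 0 ≤ β) (hγ : 0 ≤ γ) :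
    ∫⁻ t in Ioc (-R) R, ENNReal.ofReal
        (ρ t * (α * centeredCdf R ρ t ^ 4 + β * centeredCdf R ρ t ^ 2 + γ)) =
      ENNReal.ofReal ((∫ t in (-R)..R, ρ t) * (α / 5 + β / 3 + γ)) := by
  have hc := continuous_centeredCdf (R := R) hρ
  rw [← integral_mul_quartic_centeredCdf hρ, lintegral_Ioc_ofReal hR (by fun_prop)]
  intro t
  have := h0 t
  positivity

lemma lintegral_mul_deriv_centeredCdf_le (hR : 0 ≤ R) (hρ : Continuous ρ) (h0 : ∀ t, 0 ≤ ρ t)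
    {P P' : ℝ → ℝ} (hP : ∀ t, HasDerivAt P (P' t) t) (hP' : Continuous P') (hP0 : ∀ t, 0 ≤ P t)
    (hl : P (-R) = 0) (hr : P R = 0) :
    ∫⁻ t in Ioc (-R) R, ENNReal.ofReal (P t * (2 * ρ t / ∫ s in (-R)..R, ρ s)) ≤
      ∫⁻ t in Ioc (-R) R, ENNReal.ofReal (|P' t| * |centeredCdf R ρ t|) := by
  have hc := continuous_centeredCdf (R := R) hρ
  have hPc : Continuous P := continuous_iff_continuousAt.2 fun t => (hP t).continuousAt
  have hm : 0 ≤ ∫ s in (-R)..R, ρ s :=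
    intervalIntegral.integral_nonneg (by linarith) fun t _ => h0 t
  rw [lintegral_Ioc_ofReal hR (by fun_prop), lintegral_Ioc_ofReal hR (by fun_prop)]
  rotate_left
  · intro t; positivity
  · intro t
    have := h0 t
    have := hP0 t
    positivity
  refine ENNReal.ofReal_le_ofReal ?_
  rw [intervalIntegral.integral_mul_deriv_eq_deriv_mul (fun t _ => hP t)
    (fun t _ => hasDerivAt_centeredCdf (R := R) hρ t) (hP'.intervalIntegrable _ _)
    (Continuous.intervalIntegrable (by fun_prop) _ _), hl, hr]
  simp only [zero_mul, sub_zero, zero_sub]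
  rw [← intervalIntegral.integral_neg]
  refine intervalIntegral.integral_mono_on (by linarith)
    (Continuous.intervalIntegrable (by fun_prop) _ _)
    (Continuous.intervalIntegrable (by fun_prop) _ _) fun t _ => ?_
  rw [← abs_mul]
  exact neg_le_abs _

end Interval

/-! ### Knothe's rearrangement of a density on a cube -/

section Cube

open Function

variable {ι : Type*} [DecidableEq ι] {R : ℝ}

/-- Integration of `h` over the `i`-th variable, along `[-R, R]`. -/
def lineIntegral (R : ℝ) (i : ι) (h : (ι → ℝ) → ℝ) (x : ι → ℝ) : ℝ :=
  ∫ t in (-R)..R, h (update x i t)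

/-- The rescaled distribution function of the density `h` in the `i`-th variable. -/
def lineCdf (R : ℝ) (i : ι) (h : (ι → ℝ) → ℝ) (x : ι → ℝ) : ℝ :=
  centeredCdf R (fun t => h (update x i t)) (x i)

variable {i j : ι} {h : (ι → ℝ) → ℝ}

lemma continuous_lineIntegral (hh : Continuous h) : Continuous (lineIntegral R i h) :=
  intervalIntegral.continuous_parametric_intervalIntegral_of_continuous' (by fun_prop) _ _

lemma lineIntegral_nonneg (hR : 0 ≤ R) (h0 : ∀ x, 0 ≤ h x) (x : ι → ℝ) :
    0 ≤ lineIntegral R i h x :=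
  intervalIntegral.integral_nonneg (by linarith) fun _ _ => h0 _

lemma lineIntegral_pos (hR : 0 < R) (hh : Continuous h) (h0 : ∀ x, 0 ≤ h x) {x : ι → ℝ}
    (hx : x i ∈ Icc (-R) R) (hpos : 0 < h x) : 0 < lineIntegral R i h x :=
  intervalIntegral.integral_pos (by linarith) (by fun_prop) (fun _ _ => h0 _)
    ⟨x i, hx, by simpa using hpos⟩

lemma lineIntegral_update_self (x : ι → ℝ) (s : ℝ) :
    lineIntegral R i h (update x i s) = lineIntegral R i h x := by
  simp [lineIntegral]

lemma lineIntegral_update_of_ne (hij : i ≠ j) (hj : ∀ x s, h (update x j s) = h x)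
    (x : ι → ℝ) (s : ℝ) : lineIntegral R i h (update x j s) = lineIntegral R i h x := by
  simp only [lineIntegral, update_comm hij.symm, hj]

lemma lineCdf_update_self (x : ι → ℝ) (s : ℝ) :
    lineCdf R i h (update x i s) = centeredCdf R (fun t => h (update x i t)) s := by
  simp [lineCdf]

lemma lineCdf_update_of_ne (hij : i ≠ j) (hj : ∀ x s, h (update x j s) = h x)
    (x : ι → ℝ) (s : ℝ) : lineCdf R i h (update x j s) = lineCdf R i h x := by
  simp only [lineCdf, update_comm hij.symm, hj, update_of_ne hij]

lemma measurable_lineCdf [Countable ι] (hh : Continuous h) : Measurable (lineCdf R i h) := by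
  have h1 : Continuous fun x : ι → ℝ => ∫ t in (-R)..(x i), h (update x i t) :=
    intervalIntegral.continuous_parametric_intervalIntegral_of_continuous (by fun_prop)
      (continuous_apply i)
  exact ((h1.measurable.const_mul 2).div (continuous_lineIntegral hh).measurable).sub_const 1

lemma lmarginal_mul_quartic_lineCdf (hR : 0 ≤ R) (hh : Continuous h) (h0 : ∀ x, 0 ≤ h x)
    {α β γ : (ι → ℝ) → ℝ} (hα : ∀ x, 0 ≤ α x) (hβ : ∀ x, 0 ≤ β x) (hγ : ∀ x, 0 ≤ γ x)
    (hα' : ∀ x s, α (update x i s) = α x) (hβ' : ∀ x s, β (update x i s) = β x)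
    (hγ' : ∀ x s, γ (update x i s) = γ x) :
    lmarginal (fun _ => volume.restrict (Ioc (-R) R)) {i} (fun x => ENNReal.ofReal
        (h x * (α x * lineCdf R i h x ^ 4 + β x * lineCdf R i h x ^ 2 + γ x))) =
      fun x => ENNReal.ofReal (lineIntegral R i h x * (α x / 5 + β x / 3 + γ x)) := by
  rw [lmarginal_singleton]
  ext x
  simp only [lineCdf_update_self, hα', hβ', hγ']
  exact lintegral_mul_quartic_centeredCdf hR (by fun_prop) (fun _ => h0 _) (hα x) (hβ x) (hγ x)

lemma lintegral_mul_le_mul_lineCdf [Fintype ι] (hR : 0 ≤ R) (hh : Continuous h)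
    (h0 : ∀ x, 0 ≤ h x) {P P' : (ι → ℝ) → ℝ}
    (hP : ∀ x t, HasDerivAt (fun t => P (update x i t)) (P' (update x i t)) t)
    (hPc : Continuous P) (hP' : Continuous P') (hP0 : ∀ x, 0 ≤ P x)
    (hl : ∀ x, P (update x i (-R)) = 0) (hr : ∀ x, P (update x i R) = 0) :
    ∫⁻ x, ENNReal.ofReal (P x * (2 * h x / lineIntegral R i h x))
        ∂Measure.pi (fun _ : ι => volume.restrict (Ioc (-R) R)) ≤
      ∫⁻ x, ENNReal.ofReal (|P' x| * |lineCdf R i h x|)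
        ∂Measure.pi (fun _ : ι => volume.restrict (Ioc (-R) R)) := by
  have h1 := (continuous_lineIntegral (R := R) (i := i) hh).measurable
  have h2 := measurable_lineCdf (R := R) (i := i) hh
  have h3 := hh.measurable
  have h4 := hPc.measurable
  have h5 := hP'.measurable
  refine lintegral_le_of_lmarginal_le {i} (by fun_prop) ?_ ?_
  · exact ENNReal.measurable_ofReal.comp ((continuous_abs.measurable.comp h5).mul
      (continuous_abs.measurable.comp h2))
  rw [lmarginal_singleton, lmarginal_singleton]
  intro x
  simp only [lineCdf_update_self, lineIntegral_update_self]
  exact lintegral_mul_deriv_centeredCdf_le hR (by fun_prop) (fun _ => h0 _) (hP x)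
    (by fun_prop) (fun _ => hP0 _) (hl x) (hr x)

end Cube

section Knothe

open Function

variable {R : ℝ} {g : (Fin 3 → ℝ) → ℝ}

/-- The uniform measure on the cube `(-R, R]³`. -/
abbrev cubeMeasure (R : ℝ) : Measure (Fin 3 → ℝ) :=
  Measure.pi fun _ => volume.restrict (Ioc (-R) R)

lemma cubeMeasure_eq_restrict :
    cubeMeasure R = volume.restrict (univ.pi fun _ => Ioc (-R) R) := by
  rw [cubeMeasure, volume_pi, Measure.restrict_pi_pi]

/-- The marginal densities of `g` in the first `i + 1` variables. -/
def marginalDensity (R : ℝ) (g : (Fin 3 → ℝ) → ℝ) : Fin 3 → (Fin 3 → ℝ) → ℝ :=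
  ![lineIntegral R 1 (lineIntegral R 2 g), lineIntegral R 2 g, g]

/-- The mass of `g` on the cube `[-R, R]³`. -/
def cubeMass (R : ℝ) (g : (Fin 3 → ℝ) → ℝ) : ℝ :=
  lineIntegral R 0 (lineIntegral R 1 (lineIntegral R 2 g)) 0

/-- Knothe's triangular map, transporting the density `g` to the uniform density on
`[-1, 1]³`. -/
def knotheMap (R : ℝ) (g : (Fin 3 → ℝ) → ℝ) (i : Fin 3) : (Fin 3 → ℝ) → ℝ :=
  lineCdf R i (marginalDensity R g i)

lemma continuous_marginalDensity (hg : Continuous g) (i : Fin 3) :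
    Continuous (marginalDensity R g i) := by
  fin_cases i
  exacts [continuous_lineIntegral (continuous_lineIntegral hg), continuous_lineIntegral hg, hg]

lemma marginalDensity_nonneg (hR : 0 ≤ R) (h0 : ∀ x, 0 ≤ g x) (i : Fin 3) (x : Fin 3 → ℝ) :
    0 ≤ marginalDensity R g i x := by
  fin_cases i
  exacts [lineIntegral_nonneg hR (lineIntegral_nonneg hR h0) x, lineIntegral_nonneg hR h0 x, h0 x]

lemma measurable_knotheMap (hg : Continuous g) (i : Fin 3) : Measurable (knotheMap R g i) :=
  measurable_lineCdf (continuous_marginalDensity hg i)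

lemma marginalDensity_one_update_two (x : Fin 3 → ℝ) (s : ℝ) :
    marginalDensity R g 1 (update x 2 s) = marginalDensity R g 1 x :=
  lineIntegral_update_self x s

lemma marginalDensity_zero_update_two (x : Fin 3 → ℝ) (s : ℝ) :
    marginalDensity R g 0 (update x 2 s) = marginalDensity R g 0 x :=
  lineIntegral_update_of_ne (by decide) (lineIntegral_update_self (i := 2)) x s

lemma marginalDensity_zero_update_one (x : Fin 3 → ℝ) (s : ℝ) :
    marginalDensity R g 0 (update x 1 s) = marginalDensity R g 0 x :=
  lineIntegral_update_self x s

lemma lineIntegral_marginalDensity_zero (x : Fin 3 → ℝ) :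
    lineIntegral R 0 (marginalDensity R g 0) x = cubeMass R g := by
  have hx : x = update (update (update (0 : Fin 3 → ℝ) 0 (x 0)) 1 (x 1)) 2 (x 2) := by
    ext i; fin_cases i <;> simp [update]
  rw [hx, lineIntegral_update_of_ne (by decide) marginalDensity_zero_update_two,
    lineIntegral_update_of_ne (by decide) marginalDensity_zero_update_one,
    lineIntegral_update_self]
  rfl

lemma lintegral_pi_fin_three {μ : Fin 3 → Measure ℝ} [∀ i, SigmaFinite (μ i)]
    {F : (Fin 3 → ℝ) → ℝ≥0∞} (hF : Measurable F) (x : Fin 3 → ℝ) :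
    ∫⁻ x, F x ∂Measure.pi μ =
      lmarginal μ {0} (lmarginal μ {1} (lmarginal μ {2} F)) x := by
  rw [lintegral_eq_lmarginal_univ x, show (Finset.univ : Finset (Fin 3)) = {0} ∪ ({1} ∪ {2}) from
    by decide, lmarginal_union μ F hF (by decide), lmarginal_union μ F hF (by decide)]

lemma lintegral_cubeMeasure (hR : 0 ≤ R) (hg : Continuous g) (h0 : ∀ x, 0 ≤ g x) :
    ∫⁻ x, ENNReal.ofReal (g x) ∂cubeMeasure R = ENNReal.ofReal (cubeMass R g) := by
  have key : ∀ (i : Fin 3) {h : (Fin 3 → ℝ) → ℝ}, Continuous h → (∀ x, 0 ≤ h x) →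
      lmarginal (fun _ => volume.restrict (Ioc (-R) R)) {i} (fun x => ENNReal.ofReal (h x)) =
        fun x => ENNReal.ofReal (lineIntegral R i h x) := fun i h hh hh0 => by
    rw [lmarginal_singleton]
    ext x
    exact lintegral_Ioc_ofReal hR (by fun_prop) fun _ => hh0 _
  rw [lintegral_pi_fin_three (by fun_prop) 0, key 2 hg h0,
    key 1 (continuous_lineIntegral hg) (lineIntegral_nonneg hR h0),
    key 0 (continuous_lineIntegral (continuous_lineIntegral hg))
      (lineIntegral_nonneg hR (lineIntegral_nonneg hR h0))]
  rfl

lemma lmarginal_mul_quartic_knotheMap (hR : 0 ≤ R) (hg : Continuous g) (h0 : ∀ x, 0 ≤ g x)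
    (i : Fin 3) {α β γ : (Fin 3 → ℝ) → ℝ}
    (hα : ∀ x, 0 ≤ α x) (hβ : ∀ x, 0 ≤ β x) (hγ : ∀ x, 0 ≤ γ x)
    (hα' : ∀ x s, α (update x i s) = α x) (hβ' : ∀ x s, β (update x i s) = β x)
    (hγ' : ∀ x s, γ (update x i s) = γ x) :
    lmarginal (fun _ => volume.restrict (Ioc (-R) R)) {i} (fun x => ENNReal.ofReal
        (marginalDensity R g i x *
          (α x * knotheMap R g i x ^ 4 + β x * knotheMap R g i x ^ 2 + γ x))) =
      fun x => ENNReal.ofReal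
        (lineIntegral R i (marginalDensity R g i) x * (α x / 5 + β x / 3 + γ x)) :=
  lmarginal_mul_quartic_lineCdf hR (continuous_marginalDensity hg i)
    (marginalDensity_nonneg hR h0 i) hα hβ hγ hα' hβ' hγ'

/-- The fourth moment of the uniform distribution on `[-1, 1]³` is `19 / 15`. -/
lemma lintegral_mul_knotheMap_pow_four (hR : 0 ≤ R) (hg : Continuous g) (h0 : ∀ x, 0 ≤ g x) :
    ∫⁻ x, ENNReal.ofReal (g x * (∑ i, knotheMap R g i x ^ 2) ^ 2) ∂cubeMeasure R =
      ENNReal.ofReal (cubeMass R g * (19 / 15)) := by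
  have hm := measurable_knotheMap (R := R) hg
  have h02 : ∀ x s, knotheMap R g 0 (update x 2 s) = knotheMap R g 0 x :=
    lineCdf_update_of_ne (by decide) marginalDensity_zero_update_two
  have h01 : ∀ x s, knotheMap R g 0 (update x 1 s) = knotheMap R g 0 x :=
    lineCdf_update_of_ne (by decide) marginalDensity_zero_update_one
  have h12 : ∀ x s, knotheMap R g 1 (update x 2 s) = knotheMap R g 1 x :=
    lineCdf_update_of_ne (by decide) marginalDensity_one_update_two
  have hgm := hg.measurable
  rw [lintegral_pi_fin_three (by fun_prop) 0]
  have e2 : lmarginal (fun _ => volume.restrict (Ioc (-R) R)) {2}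
      (fun x => ENNReal.ofReal (g x * (∑ i, knotheMap R g i x ^ 2) ^ 2)) =
      fun x => ENNReal.ofReal (marginalDensity R g 1 x * (1 * knotheMap R g 1 x ^ 4 +
        (2 * knotheMap R g 0 x ^ 2 + 2 / 3) * knotheMap R g 1 x ^ 2 +
        (knotheMap R g 0 x ^ 4 + 2 / 3 * knotheMap R g 0 x ^ 2 + 1 / 5))) := by
    have := lmarginal_mul_quartic_knotheMap hR hg h0 2 (α := fun _ => 1)
      (β := fun x => 2 * (knotheMap R g 0 x ^ 2 + knotheMap R g 1 x ^ 2))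
      (γ := fun x => (knotheMap R g 0 x ^ 2 + knotheMap R g 1 x ^ 2) ^ 2)
      (fun _ => zero_le_one) (fun _ => by positivity) (fun _ => by positivity)
      (fun _ _ => rfl) (fun _ _ => by simp only [h02, h12]) (fun _ _ => by simp only [h02, h12])
    convert this using 3 with x x
    · congr 1
      rw [Fin.sum_univ_three]
      change _ = g x * (1 * knotheMap R g 2 x ^ 4 + _ * knotheMap R g 2 x ^ 2 + _)
      ring
    · congr 1
      ring
  have e1 := lmarginal_mul_quartic_knotheMap hR hg h0 1 (α := fun _ => 1)
      (β := fun x => 2 * knotheMap R g 0 x ^ 2 + 2 / 3)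
      (γ := fun x => knotheMap R g 0 x ^ 4 + 2 / 3 * knotheMap R g 0 x ^ 2 + 1 / 5)
      (fun _ => zero_le_one) (fun _ => by positivity) (fun _ => by positivity)
      (fun _ _ => rfl) (fun _ _ => by simp only [h01]) (fun _ _ => by simp only [h01])
  have e1' : (fun x => ENNReal.ofReal (lineIntegral R 1 (marginalDensity R g 1) x *
      (1 / 5 + (2 * knotheMap R g 0 x ^ 2 + 2 / 3) / 3 +
        (knotheMap R g 0 x ^ 4 + 2 / 3 * knotheMap R g 0 x ^ 2 + 1 / 5)))) =
      fun x => ENNReal.ofReal (marginalDensity R g 0 x * (1 * knotheMap R g 0 x ^ 4 +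
        4 / 3 * knotheMap R g 0 x ^ 2 + 28 / 45)) := by
    ext x
    congr 1
    change marginalDensity R g 0 x * _ = _
    ring
  have e0 := lmarginal_mul_quartic_knotheMap hR hg h0 0 (α := fun _ => 1)
      (β := fun x => 4 / 3) (γ := fun x => 28 / 45)
      (fun _ => zero_le_one) (fun _ => by positivity) (fun _ => by positivity)
      (fun _ _ => rfl) (fun _ _ => rfl) (fun _ _ => rfl)
  rw [e2, e1, e1', e0]
  simp only [lineIntegral_marginalDensity_zero]
  norm_num

/-- The transport inequality obtained from Knothe's map by the inequality of arithmetic and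
geometric means and integration by parts. -/
lemma lintegral_mul_rpow_le_knotheMap (hR : 0 < R) (hg : Continuous g) (h0 : ∀ x, 0 ≤ g x)
    {P : (Fin 3 → ℝ) → ℝ} {P' : Fin 3 → (Fin 3 → ℝ) → ℝ}
    (hP : ∀ i x t, HasDerivAt (fun t => P (update x i t)) (P' i (update x i t)) t)
    (hPc : Continuous P) (hP' : ∀ i, Continuous (P' i)) (hP0 : ∀ x, 0 ≤ P x)
    (hl : ∀ i x, P (update x i (-R)) = 0) (hr : ∀ i x, P (update x i R) = 0)
    (hPg : ∀ x, g x = 0 → P x = 0) :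
    ∫⁻ x, ENNReal.ofReal (6 * (P x * (g x / cubeMass R g) ^ (1 / 3 : ℝ))) ∂cubeMeasure R ≤
      ∫⁻ x, ENNReal.ofReal (∑ i, |P' i x| * |knotheMap R g i x|) ∂cubeMeasure R := by
  have hm := measurable_knotheMap (R := R) hg
  have hc := continuous_marginalDensity (R := R) hg
  have hn := marginalDensity_nonneg hR.le h0
  have hl' := fun i => (continuous_lineIntegral (R := R) (i := i) (hc i)).measurable
  have hc' := fun i => (hc i).measurable
  have hPm := hPc.measurable
  set D : Fin 3 → (Fin 3 → ℝ) → ℝ := fun i x =>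
    2 * marginalDensity R g i x / lineIntegral R i (marginalDensity R g i) x with hD
  have hDm : ∀ i, Measurable (D i) := fun i => by fun_prop
  have hD0 : ∀ i x, 0 ≤ D i x := fun i x =>
    div_nonneg (mul_nonneg zero_le_two (hn i x)) (lineIntegral_nonneg hR.le (hn i) x)
  have hpt : ∀ x ∈ univ.pi fun _ : Fin 3 => Ioc (-R) R,
      6 * (P x * (g x / cubeMass R g) ^ (1 / 3 : ℝ)) ≤ ∑ i, P x * D i x := by
    intro x hx
    rcases (h0 x).eq_or_lt with hgx | hgx
    · simp [hPg x hgx.symm]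
    have hxi : ∀ i, x i ∈ Icc (-R) R := fun i => Ioc_subset_Icc_self (hx i trivial)
    have p1 : 0 < marginalDensity R g 1 x := lineIntegral_pos hR hg h0 (hxi 2) hgx
    have p0 : 0 < marginalDensity R g 0 x := lineIntegral_pos hR (hc 1) (hn 1) (hxi 1) p1
    have pM : 0 < cubeMass R g := by
      rw [← lineIntegral_marginalDensity_zero x]
      exact lineIntegral_pos hR (hc 0) (hn 0) (hxi 0) p0
    have d0 : D 0 x = 2 * marginalDensity R g 0 x / cubeMass R g := by
      rw [← lineIntegral_marginalDensity_zero x]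
    have d1 : D 1 x = 2 * marginalDensity R g 1 x / marginalDensity R g 0 x := rfl
    have d2 : D 2 x = 2 * g x / marginalDensity R g 1 x := rfl
    have hprod : D 0 x * D 1 x * D 2 x = 2 ^ 3 * (g x / cubeMass R g) := by
      rw [d0, d1, d2]; field_simp
    have amgm := Real.geom_mean_le_arith_mean3_weighted (w₁ := 1 / 3) (w₂ := 1 / 3) (w₃ := 1 / 3)
      (by norm_num) (by norm_num) (by norm_num) (hD0 0 x) (hD0 1 x) (hD0 2 x) (by norm_num)
    rw [← Real.mul_rpow (hD0 0 x) (hD0 1 x), ← Real.mul_rpow (mul_nonneg (hD0 0 x) (hD0 1 x))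
      (hD0 2 x), hprod, Real.mul_rpow (by norm_num) (by positivity),
      show ((2 : ℝ) ^ 3) ^ (1 / 3 : ℝ) = 2 by
        rw [← Real.rpow_natCast, ← Real.rpow_mul (by norm_num)]; norm_num] at amgm
    rw [Fin.sum_univ_three]
    nlinarith [mul_le_mul_of_nonneg_left amgm (hP0 x)]
  calc _ ≤ ∫⁻ x, ∑ i, ENNReal.ofReal (P x * D i x) ∂cubeMeasure R := by
        refine lintegral_mono_ae ?_
        rw [cubeMeasure_eq_restrict]
        filter_upwards [ae_restrict_mem
          (MeasurableSet.univ_pi fun _ => measurableSet_Ioc)] with x hx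
        rw [← ENNReal.ofReal_sum_of_nonneg fun i _ => mul_nonneg (hP0 x) (hD0 i x)]
        exact ENNReal.ofReal_le_ofReal (hpt x hx)
    _ = ∑ i, ∫⁻ x, ENNReal.ofReal (P x * D i x) ∂cubeMeasure R :=
        lintegral_finsetSum _ fun i _ => by fun_prop
    _ ≤ ∑ i, ∫⁻ x, ENNReal.ofReal (|P' i x| * |knotheMap R g i x|) ∂cubeMeasure R :=
        Finset.sum_le_sum fun i _ => lintegral_mul_le_mul_lineCdf hR.le (hc i) (hn i) (hP i) hPc
          (hP' i) hP0 (hl i) (hr i)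
    _ = ∫⁻ x, ∑ i, ENNReal.ofReal (|P' i x| * |knotheMap R g i x|) ∂cubeMeasure R := by
        refine (lintegral_finsetSum _ fun i _ => ENNReal.measurable_ofReal.comp ?_).symm
        exact (continuous_abs.measurable.comp (hP' i).measurable).mul
          (continuous_abs.measurable.comp (hm i))
    _ = _ := by
        refine lintegral_congr fun x => ?_
        rw [ENNReal.ofReal_sum_of_nonneg fun i _ => by positivity]

end Knothe

/-! ### A Gagliardo–Nirenberg inequality -/

section GagliardoNirenberg

open Function

lemma two_fifths_mul_rpow_le :
    (2 / 5 * (19 / 15 : ℝ) ^ (1 / 4 : ℝ)) ^ (3 / 2 : ℝ) ≤ 2 / ((3 : ℝ) ^ ((3 : ℝ) / 4) * π) := by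
  rw [← pow_le_pow_iff_left₀ (by positivity) (by positivity) (by norm_num : 8 ≠ 0), div_pow,
    mul_pow, ← Real.rpow_natCast, ← Real.rpow_mul (by positivity),
    ← Real.rpow_natCast ((3 : ℝ) ^ ((3 : ℝ) / 4)), ← Real.rpow_mul (by positivity),
    Real.mul_rpow (by positivity) (by positivity), ← Real.rpow_mul (by positivity)]
  norm_num
  have hpi : π ^ 8 ≤ (3.1416 : ℝ) ^ 8 := by gcongr; exact Real.pi_lt_d4.le
  norm_num at hpi
  have : (0 : ℝ) < π ^ 8 := by positivity
  rw [le_div_iff₀ (by positivity)]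
  nlinarith

lemma ENNReal.rpow_le_of_mul_rpow_le {m B k : ℝ≥0∞} (hm : m ≠ ∞)
    (h : m ^ (2 / 3 : ℝ) ≤ k * B * m ^ (1 / 4 : ℝ)) :
    m ^ (5 / 8 : ℝ) ≤ k ^ (3 / 2 : ℝ) * B ^ (3 / 2 : ℝ) := by
  rcases eq_or_ne m 0 with rfl | h0
  · simp
  have h1 : m ^ (5 / 12 : ℝ) ≤ k * B := by
    rw [← ENNReal.mul_le_mul_iff_left (c := m ^ (1 / 4 : ℝ)) (by simp [h0, hm]) (by simp [h0, hm]),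
      ← ENNReal.rpow_add _ _ h0 hm]
    norm_num at h ⊢
    exact h
  have h2 := ENNReal.rpow_le_rpow h1 (by norm_num : (0 : ℝ) ≤ 3 / 2)
  rw [← ENNReal.rpow_mul, ENNReal.mul_rpow_of_nonneg _ _ (by norm_num)] at h2
  norm_num at h2 ⊢
  exact h2

lemma lintegral_rpow_le_of_vanishing_on_cube {R : ℝ} (hR : 0 < R) {f G : (Fin 3 → ℝ) → ℝ}
    {f' : Fin 3 → (Fin 3 → ℝ) → ℝ} (hf : Continuous f) (hG : Measurable G)
    (hf' : ∀ i, Continuous (f' i)) (hf0 : ∀ x, 0 ≤ f x) (hG0 : ∀ x, 0 ≤ G x)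
    (hd : ∀ i x t, HasDerivAt (fun t => f (update x i t)) (f' i (update x i t)) t)
    (hl : ∀ i x, f (update x i (-R)) = 0) (hr : ∀ i x, f (update x i R) = 0)
    (hfG : ∀ x, ∑ i, f' i x ^ 2 ≤ 4 * f x * G x) :
    ∫⁻ x, ENNReal.ofReal (f x ^ (3 / 2 : ℝ)) ∂cubeMeasure R ≤
      ENNReal.ofReal (2 / ((3 : ℝ) ^ ((3 : ℝ) / 4) * π)) *
        (∫⁻ x, ENNReal.ofReal (G x) ∂cubeMeasure R) ^ (3 / 4 : ℝ) *
        (∫⁻ x, ENNReal.ofReal (f x) ∂cubeMeasure R) ^ (3 / 4 : ℝ) := by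
  set g : (Fin 3 → ℝ) → ℝ := fun x => f x ^ (9 / 5 : ℝ) with hgdef
  have hg : Continuous g := hf.rpow_const fun _ => Or.inr (by norm_num)
  have hg0 : ∀ x, 0 ≤ g x := fun x => Real.rpow_nonneg (hf0 x) _
  set P' : Fin 3 → (Fin 3 → ℝ) → ℝ := fun i x => f' i x * (6 / 5) * f x ^ ((6 / 5 : ℝ) - 1)
    with hP'
  have hP'c : ∀ i, Continuous (P' i) := fun i =>
    ((hf' i).mul continuous_const).mul (hf.rpow_const fun _ => Or.inr (by norm_num))
  have hPc : Continuous fun x => f x ^ (6 / 5 : ℝ) := hf.rpow_const fun _ => Or.inr (by norm_num)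
  have hVm := measurable_knotheMap (R := R) hg
  have hfm := hf.measurable
  have hgm := hg.measurable
  set S : (Fin 3 → ℝ) → ℝ := fun x => ∑ i, knotheMap R g i x ^ 2 with hS
  have hS0 : ∀ x, 0 ≤ S x := fun x => Finset.sum_nonneg fun i _ => sq_nonneg _
  have hSm : Measurable S := by fun_prop
  set M := cubeMass R g with hM
  have hM0 : 0 ≤ M := lineIntegral_nonneg hR.le (lineIntegral_nonneg hR.le
    (lineIntegral_nonneg hR.le hg0)) 0
  have hmass := lintegral_cubeMeasure hR.le hg hg0
  have htrans := lintegral_mul_rpow_le_knotheMap hR hg hg0 (P := fun x => f x ^ (6 / 5 : ℝ))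
    (P' := P') (fun i x t => (hd i x t).rpow_const (Or.inr (by norm_num))) hPc hP'c
    (fun x => Real.rpow_nonneg (hf0 x) _)
    (fun i x => by simp only [hl]; exact Real.zero_rpow (by norm_num))
    (fun i x => by simp only [hr]; exact Real.zero_rpow (by norm_num))
    (fun x hx => by
      rw [(Real.rpow_eq_zero (hf0 x) (by norm_num)).1 hx]; exact Real.zero_rpow (by norm_num))
  have hlhs : ∫⁻ x, ENNReal.ofReal (6 * (f x ^ (6 / 5 : ℝ) * (g x / M) ^ (1 / 3 : ℝ)))
      ∂cubeMeasure R = 6 * ENNReal.ofReal M ^ (2 / 3 : ℝ) := by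
    have : ∀ x, 6 * (f x ^ (6 / 5 : ℝ) * (g x / M) ^ (1 / 3 : ℝ)) =
        (6 * (M ^ (1 / 3 : ℝ))⁻¹) * g x := fun x => by
      rw [Real.div_rpow (hg0 x) hM0, hgdef]
      dsimp only
      rw [← Real.rpow_mul (hf0 x), show (9 / 5 : ℝ) = 6 / 5 + 9 / 5 * (1 / 3) by norm_num,
        Real.rpow_add_of_nonneg (hf0 x) (by norm_num) (by norm_num)]
      norm_num
      ring
    simp only [this]
    simp_rw [ENNReal.ofReal_mul (show 0 ≤ 6 * (M ^ (1 / 3 : ℝ))⁻¹ by positivity)]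
    rw [lintegral_const_mul _ (by fun_prop), hmass, ← ENNReal.ofReal_mul (by positivity),
      ENNReal.ofReal_rpow_of_nonneg hM0 (by norm_num),
      show (6 : ℝ≥0∞) = ENNReal.ofReal 6 by norm_num, ← ENNReal.ofReal_mul (by norm_num)]
    congr 1
    rcases hM0.eq_or_lt with h | h
    · rw [← hM, ← h, Real.zero_rpow (by norm_num), Real.zero_rpow (by norm_num)]; simp
    · rw [← hM, mul_assoc, ← Real.rpow_neg hM0]
      nth_rw 2 [← Real.rpow_one M]
      rw [← Real.rpow_add h]
      norm_num
  have hpt : ∀ x, ∑ i, |P' i x| * |knotheMap R g i x| ≤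
      12 / 5 * (G x ^ (1 / 2 : ℝ) * f x ^ (1 / 4 : ℝ) * (g x * S x ^ 2) ^ (1 / 4 : ℝ)) := by
    intro x
    have h1 : ∑ i, |f' i x| * |knotheMap R g i x| ≤ √(4 * f x * G x) * √(S x) := by
      have := Real.sum_mul_le_sqrt_mul_sqrt Finset.univ (fun i => |f' i x|)
        (fun i => |knotheMap R g i x|)
      simp only [sq_abs] at this
      exact this.trans (by gcongr; exact hfG x)
    have h2 : √(4 * f x * G x) * √(S x) =
        2 * (f x ^ (1 / 2 : ℝ) * G x ^ (1 / 2 : ℝ) * S x ^ (1 / 2 : ℝ)) := by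
      rw [Real.sqrt_mul (by have := hf0 x; positivity), Real.sqrt_mul (by norm_num),
        show √(4 : ℝ) = 2 by rw [show (4 : ℝ) = 2 ^ 2 by norm_num]; simp]
      simp only [Real.sqrt_eq_rpow]
      ring
    have h3 : (g x * S x ^ 2) ^ (1 / 4 : ℝ) = f x ^ (9 / 20 : ℝ) * S x ^ (1 / 2 : ℝ) := by
      rw [Real.mul_rpow (hg0 x) (by positivity), hgdef]
      dsimp only
      rw [← Real.rpow_mul (hf0 x), ← Real.rpow_natCast, ← Real.rpow_mul (hS0 x)]
      norm_num
    have h4 : f x ^ ((6 / 5 : ℝ) - 1) * f x ^ (1 / 2 : ℝ) =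
        f x ^ (1 / 4 : ℝ) * f x ^ (9 / 20 : ℝ) := by
      rw [← Real.rpow_add_of_nonneg (hf0 x) (by norm_num) (by norm_num),
        ← Real.rpow_add_of_nonneg (hf0 x) (by norm_num) (by norm_num)]
      norm_num
    have h5 : ∑ i, |P' i x| * |knotheMap R g i x| =
        6 / 5 * f x ^ ((6 / 5 : ℝ) - 1) * ∑ i, |f' i x| * |knotheMap R g i x| := by
      rw [Finset.mul_sum]
      refine Finset.sum_congr rfl fun i _ => ?_
      rw [hP']
      dsimp only
      rw [abs_mul, abs_mul, abs_of_nonneg (Real.rpow_nonneg (hf0 x) _),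
        abs_of_pos (by norm_num : (0 : ℝ) < 6 / 5)]
      ring
    rw [h5, h3]
    have h6 := Real.rpow_nonneg (hf0 x) ((6 / 5 : ℝ) - 1)
    calc _ ≤ 6 / 5 * f x ^ ((6 / 5 : ℝ) - 1) *
          (2 * (f x ^ (1 / 2 : ℝ) * G x ^ (1 / 2 : ℝ) * S x ^ (1 / 2 : ℝ))) := by
          rw [← h2]; gcongr
      _ = 12 / 5 * G x ^ (1 / 2 : ℝ) * S x ^ (1 / 2 : ℝ) *
          (f x ^ ((6 / 5 : ℝ) - 1) * f x ^ (1 / 2 : ℝ)) := by ring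
      _ = _ := by rw [h4]; ring
  set W := ∫⁻ x, ENNReal.ofReal (f x) ∂cubeMeasure R with hW
  set D := ∫⁻ x, ENNReal.ofReal (G x) ∂cubeMeasure R with hDdef
  set m := ENNReal.ofReal M with hmdef
  have hrhs : ∫⁻ x, ENNReal.ofReal (∑ i, |P' i x| * |knotheMap R g i x|) ∂cubeMeasure R ≤
      ENNReal.ofReal (12 / 5) * (D ^ (1 / 2 : ℝ) * W ^ (1 / 4 : ℝ) *
        (m * ENNReal.ofReal (19 / 15)) ^ (1 / 4 : ℝ)) := by
    have holder := ENNReal.lintegral_prod_norm_pow_le (μ := cubeMeasure R) Finset.univ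
      (f := ![fun x => ENNReal.ofReal (G x), fun x => ENNReal.ofReal (f x),
        fun x => ENNReal.ofReal (g x * S x ^ 2)]) (p := ![1 / 2, 1 / 4, 1 / 4])
      (by
        intro i _
        fin_cases i
        exacts [hG.ennreal_ofReal.aemeasurable, hfm.ennreal_ofReal.aemeasurable,
          (hgm.mul (hSm.pow_const 2)).ennreal_ofReal.aemeasurable])
      (by rw [Fin.sum_univ_three]; simp; norm_num)
      (by intro i _; fin_cases i <;> simp)
    simp only [Fin.prod_univ_three, Matrix.cons_val_zero, Matrix.cons_val_one,
      Matrix.cons_val] at holder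
    rw [lintegral_mul_knotheMap_pow_four hR.le hg hg0, ENNReal.ofReal_mul hM0] at holder
    refine le_trans ?_ (mul_le_mul_right holder _)
    rw [← lintegral_const_mul' _ _ (by simp)]
    refine lintegral_mono fun x => (ENNReal.ofReal_le_ofReal (hpt x)).trans_eq ?_
    have := hG0 x
    have := hf0 x
    have := hg0 x
    rw [ENNReal.ofReal_mul (by norm_num), ENNReal.ofReal_mul (by positivity),
      ENNReal.ofReal_mul (by positivity), ENNReal.ofReal_rpow_of_nonneg (hG0 x) (by norm_num),
      ENNReal.ofReal_rpow_of_nonneg (hf0 x) (by norm_num),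
      ENNReal.ofReal_rpow_of_nonneg (by positivity) (by norm_num)]
  have hmain := (hlhs.symm.le.trans htrans).trans hrhs
  have hm58 : m ^ (5 / 8 : ℝ) ≤
      ENNReal.ofReal (2 / 5 * (19 / 15 : ℝ) ^ (1 / 4 : ℝ)) ^ (3 / 2 : ℝ) *
        (D ^ (1 / 2 : ℝ) * W ^ (1 / 4 : ℝ)) ^ (3 / 2 : ℝ) := by
    refine ENNReal.rpow_le_of_mul_rpow_le ENNReal.ofReal_ne_top ?_
    rw [← ENNReal.mul_le_mul_iff_right (a := 6) (by norm_num) (by norm_num)]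
    refine hmain.trans_eq ?_
    rw [ENNReal.mul_rpow_of_nonneg _ _ (by norm_num), ENNReal.ofReal_mul (by norm_num),
      ← ENNReal.ofReal_rpow_of_nonneg (by norm_num) (by norm_num),
      show (12 / 5 : ℝ) = 6 * (2 / 5) by norm_num, ENNReal.ofReal_mul (by norm_num),
      show ENNReal.ofReal 6 = 6 by norm_num]
    ring
  have hinterp : ∫⁻ x, ENNReal.ofReal (f x ^ (3 / 2 : ℝ)) ∂cubeMeasure R ≤
      W ^ (3 / 8 : ℝ) * m ^ (5 / 8 : ℝ) := by
    rw [← hmass]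
    refine le_trans (lintegral_mono fun x => ?_) (ENNReal.lintegral_mul_norm_pow_le
      hfm.ennreal_ofReal.aemeasurable hgm.ennreal_ofReal.aemeasurable
      (by norm_num) (by norm_num) (by norm_num))
    rw [ENNReal.ofReal_rpow_of_nonneg (hf0 x) (by norm_num),
      ENNReal.ofReal_rpow_of_nonneg (hg0 x) (by norm_num),
      ← ENNReal.ofReal_mul (Real.rpow_nonneg (hf0 x) _), hgdef]
    dsimp only
    rw [← Real.rpow_mul (hf0 x),
      ← Real.rpow_add_of_nonneg (hf0 x) (by norm_num) (by norm_num)]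
    norm_num
  refine hinterp.trans ((mul_le_mul_right hm58 _).trans ?_)
  rw [ENNReal.mul_rpow_of_nonneg _ _ (by norm_num), ← ENNReal.rpow_mul, ← ENNReal.rpow_mul,
    ENNReal.ofReal_rpow_of_nonneg (by positivity) (by norm_num)]
  calc _ = ENNReal.ofReal ((2 / 5 * (19 / 15 : ℝ) ^ (1 / 4 : ℝ)) ^ (3 / 2 : ℝ)) *
        D ^ (1 / 2 * (3 / 2) : ℝ) * (W ^ (3 / 8 : ℝ) * W ^ (1 / 4 * (3 / 2) : ℝ)) := by ring
    _ ≤ _ := by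
      rw [← ENNReal.rpow_add_of_nonneg _ _ (by norm_num) (by norm_num),
        show (1 / 2 * (3 / 2) : ℝ) = 3 / 4 by norm_num,
        show (3 / 8 + 1 / 4 * (3 / 2) : ℝ) = 3 / 4 by norm_num]
      gcongr
      exact two_fifths_mul_rpow_le

end GagliardoNirenberg

section EuclideanSpace

open Function

lemma toLp_update (x : Fin 3 → ℝ) (i : Fin 3) (t : ℝ) :
    WithLp.toLp 2 (update x i t) = WithLp.toLp 2 (update x i 0) + t • e3 i := by
  ext j
  rcases eq_or_ne j i with rfl | h <;> simp [e3, *]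

lemma hasDerivAt_comp_toLp_update {w : E3 → E3} (hw : Differentiable ℝ w) (i : Fin 3)
    (x : Fin 3 → ℝ) (t : ℝ) :
    HasDerivAt (fun t => w (WithLp.toLp 2 (update x i t)))
      (pd i w (WithLp.toLp 2 (update x i t))) t := by
  have h : HasDerivAt (fun t : ℝ => WithLp.toLp 2 (update x i t)) (e3 i) t := by
    rw [funext (toLp_update x i)]
    simpa using ((hasDerivAt_id t).smul_const (e3 i)).const_add (WithLp.toLp 2 (update x i 0))
  exact (hw _).hasFDerivAt.comp_hasDerivAt t h

lemma gradSqV_eq_sum_norm_sq (w : E3 → E3) (x : E3) : gradSqV w x = ∑ i, ‖pd i w x‖ ^ 2 := by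
  simp [gradSqV, EuclideanSpace.norm_sq_eq]

/-- A Gagliardo–Nirenberg inequality, whose constant is the `3 / 2` power of the sharp Sobolev
constant of ℝ³. -/
theorem lintegral_norm_pow_three_le {w : E3 → E3} (hw : ContDiff ℝ 1 w)
    (hc : HasCompactSupport w) :
    ∫⁻ x, ENNReal.ofReal (‖w x‖ ^ 3) ≤
      ENNReal.ofReal (2 / ((3 : ℝ) ^ ((3 : ℝ) / 4) * π)) *
        (∫⁻ x, ENNReal.ofReal (gradSqV w x)) ^ (3 / 4 : ℝ) *
        (∫⁻ x, ENNReal.ofReal (‖w x‖ ^ 2)) ^ (3 / 4 : ℝ) := by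
  have hpd : ∀ i, Continuous (pd i w) := fun i =>
    (hw.continuous_fderiv (by norm_num)).clm_apply continuous_const
  have hgrad : Continuous (gradSqV w) := by
    simp only [funext (gradSqV_eq_sum_norm_sq w)]
    fun_prop
  have hwc := hw.continuous
  have hL : Continuous fun x : Fin 3 → ℝ => (WithLp.toLp 2 x : E3) :=
    PiLp.continuous_toLp 2 _
  obtain ⟨R, hR, hsupp⟩ : ∃ R > 0, ∀ x : E3, R ≤ ‖x‖ → w x = 0 := by
    obtain ⟨r, hr⟩ := hc.isCompact.isBounded.subset_closedBall 0
    refine ⟨|r| + 1, by positivity, fun x hx => image_eq_zero_of_notMem_tsupport fun hmem => ?_⟩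
    have := mem_closedBall_zero_iff.1 (hr hmem)
    linarith [le_abs_self r]
  have hout : ∀ (x : Fin 3 → ℝ) (i : Fin 3), R ≤ |x i| → w (WithLp.toLp 2 x) = 0 := fun x i hi =>
    hsupp _ (hi.trans (PiLp.norm_apply_le (WithLp.toLp 2 x : E3) i))
  have key := lintegral_rpow_le_of_vanishing_on_cube hR
    (f := fun x => ‖w (WithLp.toLp 2 x)‖ ^ 2) (G := fun x => gradSqV w (WithLp.toLp 2 x))
    (f' := fun i x => 2 * inner ℝ (w (WithLp.toLp 2 x)) (pd i w (WithLp.toLp 2 x)))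
    (by fun_prop) (hgrad.comp hL).measurable (fun i => by fun_prop) (fun x => by positivity)
    (fun x => by rw [gradSqV_eq_sum_norm_sq]; positivity)
    (fun i x t => (hasDerivAt_comp_toLp_update (hw.differentiable (by norm_num)) i x t).norm_sq)
    (fun i x => by rw [hout _ i (by simp [le_abs_self])]; simp)
    (fun i x => by rw [hout _ i (by simp [le_abs_self])]; simp)
    (fun x => by
      rw [gradSqV_eq_sum_norm_sq, Finset.mul_sum]
      refine Finset.sum_le_sum fun i _ => ?_
      have h := pow_le_pow_left₀ (abs_nonneg _)
        (abs_real_inner_le_norm (w (WithLp.toLp 2 x)) (pd i w (WithLp.toLp 2 x))) 2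
      rw [sq_abs, mul_pow] at h
      linarith)
  have hmp := PiLp.volume_preserving_toLp (Fin 3)
  rw [← hmp.lintegral_comp (by fun_prop), ← hmp.lintegral_comp (by fun_prop),
    ← hmp.lintegral_comp (by fun_prop)]
  rw [cubeMeasure_eq_restrict] at key
  refine le_trans (le_of_eq ?_) (key.trans ?_)
  · have hpow : ∀ x : E3, (‖w x‖ ^ 2) ^ (3 / 2 : ℝ) = ‖w x‖ ^ 3 := fun x => by
      rw [← Real.rpow_natCast, ← Real.rpow_mul (norm_nonneg _), ← Real.rpow_natCast]
      norm_num
    simp only [hpow]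
    refine (setLIntegral_eq_of_support_subset fun x hx => ?_).symm
    simp only [mem_univ_pi, mem_Ioc]
    intro i
    by_contra hi
    refine hx ?_
    have : R ≤ |x i| := by
      rw [le_abs]
      by_contra! h
      exact hi ⟨by linarith, h.1.le⟩
    simp [hout x i this]
  · gcongr <;> exact Measure.restrict_le_self

end EuclideanSpace

/-- Hölder's inequality, for a factor `B` that need not be measurable. -/
lemma lintegral_le_of_ae_le_mul_rpow {T : Type*} [MeasurableSpace T] {μ : Measure T}
    {A B C : T → ℝ≥0∞} (hA : AEMeasurable A μ) (hC : AEMeasurable C μ) {k : ℝ≥0∞}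
    (hk0 : k ≠ 0) (hk : k ≠ ∞) (hC_top : ∀ᵐ t ∂μ, C t ≠ ∞)
    (h : ∀ᵐ t ∂μ, A t ≤ k * B t ^ (3 / 4 : ℝ) * C t ^ (1 / 4 : ℝ)) :
    ∫⁻ t, A t ∂μ ≤ k * (∫⁻ t, B t ∂μ) ^ (3 / 4 : ℝ) * (∫⁻ t, C t ∂μ) ^ (1 / 4 : ℝ) := by
  set D : T → ℝ≥0∞ := fun t => (k⁻¹ * A t * (C t ^ (1 / 4 : ℝ))⁻¹) ^ (4 / 3 : ℝ) with hD
  have hDpow : ∀ t, D t ^ (3 / 4 : ℝ) = k⁻¹ * A t * (C t ^ (1 / 4 : ℝ))⁻¹ := fun t => by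
    rw [hD, ← ENNReal.rpow_mul]; norm_num
  have hDm : AEMeasurable D μ :=
    ((hA.const_mul _).mul (hC.pow_const _).inv).pow_const _
  have hDB : ∀ᵐ t ∂μ, D t ≤ B t := by
    filter_upwards [h] with t ht
    refine (ENNReal.rpow_le_rpow_iff (by norm_num : (0 : ℝ) < 3 / 4)).1 ?_
    rw [hDpow]
    calc _ ≤ k⁻¹ * (k * B t ^ (3 / 4 : ℝ) * C t ^ (1 / 4 : ℝ)) * (C t ^ (1 / 4 : ℝ))⁻¹ := by
          gcongr
      _ = (k * k⁻¹) * B t ^ (3 / 4 : ℝ) * (C t ^ (1 / 4 : ℝ) * (C t ^ (1 / 4 : ℝ))⁻¹) := by ring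
      _ ≤ 1 * B t ^ (3 / 4 : ℝ) * 1 := by
          gcongr
          exacts [ENNReal.mul_inv_le_one _, ENNReal.mul_inv_le_one _]
      _ = _ := by simp
  have hAD : ∀ᵐ t ∂μ, A t ≤ k * (D t ^ (3 / 4 : ℝ) * C t ^ (1 / 4 : ℝ)) := by
    filter_upwards [h, hC_top] with t ht htop
    rw [hDpow]
    rcases eq_or_ne (C t) 0 with h0 | h0
    · simpa [h0] using ht
    · have h1 : C t ^ (1 / 4 : ℝ) ≠ 0 := by simp [h0, htop]
      have h2 : C t ^ (1 / 4 : ℝ) ≠ ∞ := by simp [h0, htop]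
      rw [mul_assoc, ENNReal.inv_mul_cancel h1 h2, mul_one, ← mul_assoc,
        ENNReal.mul_inv_cancel hk0 hk, one_mul]
  calc ∫⁻ t, A t ∂μ ≤ k * ∫⁻ t, D t ^ (3 / 4 : ℝ) * C t ^ (1 / 4 : ℝ) ∂μ :=
        (lintegral_mono_ae hAD).trans_eq (lintegral_const_mul' _ _ hk)
    _ ≤ k * ((∫⁻ t, D t ∂μ) ^ (3 / 4 : ℝ) * (∫⁻ t, C t ∂μ) ^ (1 / 4 : ℝ)) := by
        gcongr
        exact ENNReal.lintegral_mul_norm_pow_le hDm hC (by norm_num) (by norm_num) (by norm_num)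
    _ ≤ _ := by
        rw [← mul_assoc]
        gcongr k * ?_ ^ _ * _
        exact lintegral_mono_ae hDB

/-- Interpolation + sharp Sobolev + Hölder in time: for `u(·,t̄)` smooth and compactly
supported for a.e. `t̄ > σ`,
`∫_σ^∞ ‖u(·,t̄)‖³_{L³} e^{−a(t̄−σ)} dt̄ ≤ (2/(3^{3/4}π)) ·
  (∫_σ^∞ ‖∇u(·,t̄)‖²_{L²} e^{−(2/3)a(t̄−σ)} dt̄)^{3/4} ·
  (∫_σ^∞ ‖u(·,t̄)‖⁶_{L²} e^{−2a(t̄−σ)} dt̄)^{1/4}`. -/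
theorem stmt_8 (a σ : ℝ) (ha : 0 < a)
    (u : ℝ → E3 → E3)
    (hmeas : Measurable fun q : E3 × ℝ => u q.2 q.1)
    (hreg : ∀ᵐ t ∂(volume.restrict (Ioi σ)),
      ContDiff ℝ (⊤ : ℕ∞) (u t) ∧ HasCompactSupport (u t)) :
    (∫⁻ t in Ioi σ,
        (∫⁻ x : E3, ENNReal.ofReal (‖u t x‖ ^ 3)) *
          ENNReal.ofReal (Real.exp (-a * (t - σ))))
      ≤ ENNReal.ofReal (2 / ((3 : ℝ) ^ ((3 : ℝ) / 4) * π)) *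
        (∫⁻ t in Ioi σ,
            (∫⁻ x : E3, ENNReal.ofReal (gradSqV (u t) x)) *
              ENNReal.ofReal (Real.exp (-(2 / 3) * a * (t - σ)))) ^ ((3 : ℝ) / 4) *
        (∫⁻ t in Ioi σ,
            (∫⁻ x : E3, ENNReal.ofReal (‖u t x‖ ^ 2)) ^ (3 : ℝ) *
              ENNReal.ofReal (Real.exp (-2 * a * (t - σ)))) ^ ((1 : ℝ) / 4) := by
  have hu : Measurable fun q : ℝ × E3 => u q.1 q.2 := hmeas.comp measurable_swap
  have hc0 : ENNReal.ofReal (2 / ((3 : ℝ) ^ ((3 : ℝ) / 4) * π)) ≠ 0 := by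
    rw [Ne, ENNReal.ofReal_eq_zero, not_le]
    positivity
  refine lintegral_le_of_ae_le_mul_rpow ?_ ?_ hc0 ENNReal.ofReal_ne_top ?_ ?_
  · exact ((Measurable.lintegral_prod_right' (f := fun q : ℝ × E3 =>
      ENNReal.ofReal (‖u q.1 q.2‖ ^ 3)) (by fun_prop)).mul (by fun_prop)).aemeasurable
  · exact (((Measurable.lintegral_prod_right' (f := fun q : ℝ × E3 =>
      ENNReal.ofReal (‖u q.1 q.2‖ ^ 2)) (by fun_prop)).pow_const _).mul (by fun_prop)).aemeasurable
  · filter_upwards [hreg] with t ⟨hs, hsupp⟩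
    have hint : Integrable fun x => ‖u t x‖ ^ 2 :=
      (hs.continuous.norm.pow 2).integrable_of_hasCompactSupport
        (hsupp.mono fun x hx h => hx (by simp [h]))
    have hfin := hint.lintegral_lt_top.ne
    refine ENNReal.mul_ne_top ?_ ENNReal.ofReal_ne_top
    rw [Ne, ENNReal.rpow_eq_top_iff_of_pos (by norm_num)]
    exact hfin
  · filter_upwards [hreg] with t ⟨hs, hsupp⟩
    have hexp : ENNReal.ofReal (Real.exp (-a * (t - σ))) =
        ENNReal.ofReal (Real.exp (-(2 / 3) * a * (t - σ))) ^ (3 / 4 : ℝ) *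
          ENNReal.ofReal (Real.exp (-2 * a * (t - σ))) ^ (1 / 4 : ℝ) := by
      rw [ENNReal.ofReal_rpow_of_pos (Real.exp_pos _), ENNReal.ofReal_rpow_of_pos (Real.exp_pos _),
        ← Real.exp_mul, ← Real.exp_mul, ← ENNReal.ofReal_mul (Real.exp_pos _).le, ← Real.exp_add]
      ring_nf
    rw [ENNReal.mul_rpow_of_nonneg _ _ (by norm_num), ENNReal.mul_rpow_of_nonneg _ _ (by norm_num),
      ← ENNReal.rpow_mul, hexp, show (3 * (1 / 4) : ℝ) = 3 / 4 by norm_num]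
    refine (mul_le_mul_left (lintegral_norm_pow_three_le (hs.of_le (by simp)) hsupp) _).trans_eq ?_
    ring
end
end

section
/- For every smooth compactly supported function u : ℝ³ → ℝ³, one has ‖u‖_{L⁶(ℝ³)} ≤ 2^{2/3}·3^{−1/2}·π^{−2/3}·‖∇u‖_{L²(ℝ³)}; equivalently, ‖u‖_{L⁶(ℝ³)}^{3/2} ≤ (2/(3^{3/4}π))·‖∇u‖_{L²(ℝ³)}^{3/2}. -/
open MeasureTheory Set Real

noncomputable section

theorem exists_quantile {h : ℝ → ℝ} (hc : Continuous h) (hpos : ∀ t, 0 < h t) {A : ℝ}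
    (hA : 0 < A) :
    ∃ Q k : ℝ → ℝ, Continuous Q ∧ Continuous k ∧ (∀ t, 0 < k t) ∧
      (∀ t ∈ Icc (-A) A, k t = h t) ∧ (∀ s, HasDerivAt Q (k (Q s))⁻¹ s) ∧ StrictMono Q ∧
      Q 0 = -A ∧ Q (∫ t in (-A)..A, h t) = A := by
  have hAA : -A ≤ A := by linarith
  obtain ⟨t₀, -, ht₀⟩ := isCompact_Icc.exists_isMinOn (nonempty_Icc.2 hAA) hc.continuousOn
  set k : ℝ → ℝ := fun t => h (projIcc (-A) A hAA t) with hk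
  have hkc : Continuous k := hc.comp (continuous_subtype_val.comp continuous_projIcc)
  have hkpos : ∀ t, 0 < k t := fun t => hpos _
  have hkh : ∀ t ∈ Icc (-A) A, k t = h t := fun t ht => by simp [hk, projIcc_of_mem hAA ht]
  have hkm : ∀ t, h t₀ ≤ k t := fun t => ht₀ (projIcc (-A) A hAA t).2
  set H : ℝ → ℝ := fun s => ∫ t in (-A)..s, k t with hH
  have hHd : ∀ s, HasDerivAt H (k s) s := fun s =>
    intervalIntegral.integral_hasDerivAt_right (hkc.intervalIntegrable _ _)
      hkc.stronglyMeasurable.stronglyMeasurableAtFilter hkc.continuousAt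
  have hHdiff : Differentiable ℝ H := fun s => (hHd s).differentiableAt
  have hmono : StrictMono H := strictMono_of_deriv_pos fun s => by
    rw [(hHd s).deriv]; exact hkpos s
  have hlin : Monotone fun s => H s - h t₀ * s := by
    refine monotone_of_deriv_nonneg (hHdiff.sub (by fun_prop)) fun s => ?_
    have := (hHd s).sub ((hasDerivAt_id s).const_mul (h t₀))
    have e := this.deriv
    simp only [id, mul_one] at e
    change 0 ≤ deriv (H - fun s => h t₀ * s) s
    rw [e]; linarith [hkm s]
  have hH0 : H (-A) = 0 := by simp [hH]
  have hsurj : Function.Surjective H := by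
    refine hHdiff.continuous.surjective ?_ ?_
    · refine Filter.tendsto_atTop_mono' _ ?_
        ((Filter.tendsto_id.const_mul_atTop (hpos t₀)).atTop_add
          (tendsto_const_nhds (x := h t₀ * A)))
      filter_upwards [Filter.eventually_ge_atTop (-A)] with s hs
      have := hlin hs
      simp only [hH0, id] at this ⊢
      linarith
    · refine Filter.tendsto_atBot_mono' _ ?_
        ((Filter.tendsto_id.const_mul_atBot (hpos t₀)).atBot_add
          (tendsto_const_nhds (x := h t₀ * A)))
      filter_upwards [Filter.eventually_le_atBot (-A)] with s hs
      have := hlin hs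
      simp only [hH0, id] at this ⊢
      linarith
  let e := hmono.orderIsoOfSurjective H hsurj
  have he : ∀ s, H (e.symm s) = s := fun s => e.apply_symm_apply s
  have hsymm : ∀ s, e.symm (H s) = s := fun s => e.symm_apply_apply s
  refine ⟨e.symm, k, e.symm.continuous, hkc, hkpos, hkh, fun s => ?_, e.symm.strictMono, ?_, ?_⟩
  · exact (hHd _).of_local_left_inverse e.symm.continuous.continuousAt (hkpos _).ne'
      (Filter.Eventually.of_forall he)
  · rw [← hH0, hsymm]
  · have : ∫ t in (-A)..A, h t = H A := by
      refine intervalIntegral.integral_congr fun t ht => ?_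
      rw [uIcc_of_le hAA] at ht
      exact (hkh t ht).symm
    rw [this, hsymm]

/-- One-dimensional monotone transport of the density `p` to the density `h` on `[-A, A]`. -/
theorem exists_transport {h : ℝ → ℝ} (hc : Continuous h) (hpos : ∀ t, 0 < h t) {A : ℝ}
    (hA : 0 < A) {R : ℝ} (hR : 0 < R) {p : ℝ → ℝ} (hp : Continuous p) (hp0 : ∀ x, 0 ≤ p x)
    (hP : 0 < ∫ x in (-R)..R, p x) :
    ∃ τ τ' : ℝ → ℝ, Continuous τ ∧ Continuous τ' ∧ (∀ x, HasDerivAt τ (τ' x) x) ∧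
      (∀ x, 0 ≤ τ' x) ∧
      (∀ x ∈ Icc (-R) R,
        τ' x * ((∫ x in (-R)..R, p x) * h (τ x)) = (∫ t in (-A)..A, h t) * p x) ∧
      ∫ x in (-R)..R, p x * (1 + τ x ^ 2) =
        (∫ t in (-A)..A, h t * (1 + t ^ 2)) / (∫ t in (-A)..A, h t) * ∫ x in (-R)..R, p x := by
  obtain ⟨Q, k, hQc, hkc, hkpos, hkh, hQd, hQm, hQ0, hQZ⟩ := exists_quantile hc hpos hA
  set Z := ∫ t in (-A)..A, h t with hZ
  set P := ∫ x in (-R)..R, p x with hPdef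
  have hZpos : 0 < Z := intervalIntegral.intervalIntegral_pos_of_pos_on
    (hc.intervalIntegrable _ _) (fun t _ => hpos t) (by linarith)
  set c : ℝ → ℝ := fun x => ∫ y in (-R)..x, p y with hcdef
  have hcd : ∀ x, HasDerivAt c (p x) x := fun x =>
    intervalIntegral.integral_hasDerivAt_right (hp.intervalIntegrable _ _)
      hp.stronglyMeasurable.stronglyMeasurableAtFilter hp.continuousAt
  have hcc : Continuous c := continuous_iff_continuousAt.2 fun x => (hcd x).continuousAt
  have hcmono : Monotone c := monotone_of_deriv_nonneg (fun x => (hcd x).differentiableAt)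
    fun x => by rw [(hcd x).deriv]; exact hp0 x
  have hc0 : c (-R) = 0 := by simp [hcdef]
  have hcR : c R = P := rfl
  set τ : ℝ → ℝ := fun x => Q (Z / P * c x) with hτ
  set τ' : ℝ → ℝ := fun x => (k (τ x))⁻¹ * (Z / P * p x) with hτ'
  have hτc : Continuous τ := hQc.comp (continuous_const.mul hcc)
  have hτc' : Continuous τ' :=
    ((hkc.comp hτc).inv₀ fun x => (hkpos _).ne').mul (continuous_const.mul hp)
  have hτd : ∀ x, HasDerivAt τ (τ' x) x := fun x =>
    (hQd _).comp x ((hcd x).const_mul (Z / P))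
  have hZP : 0 < Z / P := div_pos hZpos hP
  have hm : Monotone τ := fun x y hxy =>
    hQm.monotone (mul_le_mul_of_nonneg_left (hcmono hxy) hZP.le)
  have hτl : τ (-R) = -A := by simp [hτ, hc0, hQ0]
  have hτr : τ R = A := by
    simp only [hτ, hcR]; rw [div_mul_cancel₀ _ hP.ne', hQZ]
  have hmem : ∀ x ∈ Icc (-R) R, τ x ∈ Icc (-A) A := fun x hx =>
    ⟨hτl ▸ hm hx.1, hτr ▸ hm hx.2⟩
  have hkey : ∀ x ∈ Icc (-R) R, τ' x * (P * h (τ x)) = Z * p x := fun x hx => by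
    rw [← hkh _ (hmem x hx)]
    have := (hkpos (τ x)).ne'
    simp only [hτ']; field_simp
  refine ⟨τ, τ', hτc, hτc', hτd, fun x => ?_, hkey, ?_⟩
  · exact mul_nonneg (inv_nonneg.2 (hkpos _).le) (mul_nonneg hZP.le (hp0 x))
  · have e1 : ∫ x in (-R)..R, p x * (1 + τ x ^ 2) =
        ∫ x in (-R)..R, P / Z * (((fun t => h t * (1 + t ^ 2)) ∘ τ) x * τ' x) := by
      refine intervalIntegral.integral_congr fun x hx => ?_
      rw [uIcc_of_le (by linarith)] at hx
      have := hkey x hx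
      have : p x = P / Z * (τ' x * h (τ x)) := by
        field_simp; linarith
      simp only [Function.comp]
      rw [this]; ring
    rw [e1, intervalIntegral.integral_const_mul, intervalIntegral.integral_comp_mul_deriv
      (fun x _ => hτd x) hτc'.continuousOn (by fun_prop), hτl, hτr]
    ring

/-- `(1 + t²)^(-k/2)`. -/
def prof (k : ℕ) (t : ℝ) : ℝ := (√(1 + t ^ 2) ^ k)⁻¹

/-- Mass of `prof k` on `[-A, A]`. -/
def mass (k : ℕ) (A : ℝ) : ℝ := ∫ t in (-A)..A, prof k t

/-- Mean of `1 + t²` under the normalised density `prof k` on `[-A, A]`. -/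
def moment (k : ℕ) (A : ℝ) : ℝ := (∫ t in (-A)..A, prof k t * (1 + t ^ 2)) / mass k A

theorem sqrt_one_add_sq_pos (t : ℝ) : 0 < √(1 + t ^ 2) := Real.sqrt_pos.2 (by positivity)

theorem prof_pos (k : ℕ) (t : ℝ) : 0 < prof k t := inv_pos.2 (pow_pos (sqrt_one_add_sq_pos t) k)

theorem continuous_prof (k : ℕ) : Continuous (prof k) := by
  unfold prof
  exact Continuous.inv₀ (by fun_prop) fun t => (pow_pos (sqrt_one_add_sq_pos t) k).ne'

theorem mass_pos (k : ℕ) {A : ℝ} (hA : 0 < A) : 0 < mass k A :=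
  intervalIntegral.intervalIntegral_pos_of_pos_on
    ((continuous_prof k).intervalIntegrable _ _) (fun t _ => prof_pos k t) (by linarith)

theorem exists_transport_prof (k : ℕ) {A : ℝ}
    (hA : 0 < A) {R : ℝ} (hR : 0 < R) {p B B' N : ℝ → ℝ} {l : ℝ} (hp : Continuous p)
    (hp0 : ∀ x, 0 ≤ p x) (hP : 0 < ∫ x in (-R)..R, p x) (hB' : Continuous B') (hN : Continuous N)
    (hBd : ∀ x, HasDerivAt B (B' x) x) (hBl : B (-R) = 0) (hBr : B R = 0)
    (hdom : ∀ x s, -(B' x * s) ≤ 2 * l * (p x * s ^ 2) + 2 / l * N x) :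
    ∃ τ τ' : ℝ → ℝ, Continuous τ ∧ Continuous τ' ∧ (∀ x, 0 ≤ τ' x) ∧
      (∀ x ∈ Icc (-R) R,
        τ' x * (∫ x in (-R)..R, p x) = mass k A * p x * √(1 + τ x ^ 2) ^ k) ∧
      (∫ x in (-R)..R, p x * (1 + τ x ^ 2) = moment k A * ∫ x in (-R)..R, p x) ∧
      ∀ c : ℝ, ∫ x in (-R)..R, B x * (c * τ' x) ≤
        2 * l * c ^ 2 * (moment k A - 1) * (∫ x in (-R)..R, p x) +
          2 / l * ∫ x in (-R)..R, N x := by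
  obtain ⟨τ, τ', hτ, hτ', hd, h0, hkey, hmom⟩ :=
    exists_transport (continuous_prof k) (prof_pos k) hA hR hp hp0 hP
  have hBc : Continuous B := continuous_iff_continuousAt.2 fun x => (hBd x).continuousAt
  refine ⟨τ, τ', hτ, hτ', h0, fun x hx => ?_, hmom, fun c => ?_⟩
  · have := hkey x hx
    rw [mass, ← this, prof]
    have := (pow_pos (sqrt_one_add_sq_pos (τ x)) k).ne'
    field_simp
  · rw [intervalIntegral.integral_mul_deriv_eq_deriv_mul (fun x _ => hBd x)
      (v := fun x => c * τ x) (fun x _ => (hd x).const_mul c) (hB'.intervalIntegrable _ _)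
      ((continuous_const.mul hτ').intervalIntegrable _ _), hBl, hBr]
    have e : ∫ x in (-R)..R, p x * τ x ^ 2 = (moment k A - 1) * ∫ x in (-R)..R, p x := by
      rw [sub_mul, one_mul, ← show _ = moment k A * _ from hmom, ← intervalIntegral.integral_sub]
      · exact intervalIntegral.integral_congr fun x _ => by ring
      · exact (by fun_prop : Continuous _).intervalIntegrable _ _
      · exact hp.intervalIntegrable _ _
    have e2 : 2 * l * c ^ 2 * (moment k A - 1) * (∫ x in (-R)..R, p x) +
          2 / l * ∫ x in (-R)..R, N x =
        ∫ x in (-R)..R, (2 * l * (p x * (c * τ x) ^ 2) + 2 / l * N x) := by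
      rw [mul_assoc, ← e, ← intervalIntegral.integral_const_mul, ←
        intervalIntegral.integral_const_mul, ← intervalIntegral.integral_add]
      · exact intervalIntegral.integral_congr fun x _ => by ring
      · exact (by fun_prop : Continuous _).intervalIntegrable _ _
      · exact (by fun_prop : Continuous _).intervalIntegrable _ _
    rw [e2, zero_mul, zero_mul, sub_zero, zero_sub, ← intervalIntegral.integral_neg]
    refine intervalIntegral.integral_mono (by linarith)
      ((by fun_prop : Continuous _).intervalIntegrable _ _)
      ((by fun_prop : Continuous _).intervalIntegrable _ _) fun x => hdom x _

theorem three_mul_le_add_of_cube_eq {a b d y : ℝ} (ha : 0 ≤ a) (hb : 0 ≤ b) (hd : 0 ≤ d)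
    (h : y ^ 3 = a * b * d) : 3 * y ≤ a + b + d := by
  refine le_of_pow_le_pow_left₀ (n := 3) (by norm_num) (by positivity) ?_
  rw [mul_pow, h]
  nlinarith [mul_nonneg ha (sq_nonneg (b - d)), mul_nonneg hb (sq_nonneg (a - d)),
    mul_nonneg hd (sq_nonneg (a - b)), mul_nonneg (add_nonneg (add_nonneg ha hb) hd)
      (add_nonneg (add_nonneg (sq_nonneg (a - b)) (sq_nonneg (b - d))) (sq_nonneg (a - d)))]

theorem intervalIntegral_nonneg {R : ℝ} (hR : 0 < R) {f : ℝ → ℝ} (hf : ∀ x, 0 ≤ f x) :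
    0 ≤ ∫ x in (-R)..R, f x :=
  intervalIntegral.integral_nonneg (by linarith) fun x _ => hf x

/-- The transport estimate in one variable, for a section of the final function. -/
theorem transport_estimate_one {A R l : ℝ} (hA : 0 < A) (hR : 0 < R) (hl : 0 < l) {q q' N : ℝ → ℝ}
    (hq : Continuous q) (hq' : Continuous q') (hN : Continuous N) (hq0 : ∀ x, 0 ≤ q x)
    (hN0 : ∀ x, 0 ≤ N x) (hqd : ∀ x, HasDerivAt q (q' x) x) (hql : q (-R) = 0) (hqr : q R = 0)
    (hdom : ∀ x s, -(2 * q x * q' x * s) ≤ 2 * l * (q x ^ 3 * s ^ 2) + 2 / l * N x)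
    {κ a b c : ℝ} (ha : 0 ≤ a) (hb : 0 ≤ b) (hc : 0 ≤ c)
    (h : κ ^ 3 * c ^ 6 * (∫ x in (-R)..R, q x ^ 3) = a * b * c * mass 6 A) :
    3 * κ * c ^ 2 * moment 6 A * (∫ x in (-R)..R, q x ^ 3) ≤
      (a + b) * (∫ x in (-R)..R, q x ^ 2) +
      2 * l * c ^ 2 * (moment 6 A - 1) * (∫ x in (-R)..R, q x ^ 3) +
      2 / l * ∫ x in (-R)..R, N x := by
  have hN1 := intervalIntegral_nonneg hR hN0
  have hB1 := intervalIntegral_nonneg hR fun x => sq_nonneg (q x)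
  have hP1 := intervalIntegral_nonneg hR fun x => pow_nonneg (hq0 x) 3
  rcases hP1.eq_or_lt with hP | hP
  · rw [← hP]; simp only [mul_zero, add_zero]; positivity
  obtain ⟨τ, τ', hτ, hτ', h0, hkey, hmom, hbd⟩ := exists_transport_prof 6 hA hR
    (p := fun x => q x ^ 3)
    (B := fun x => q x ^ 2) (B' := fun x => 2 * q x * q' x) (l := l) (by fun_prop)
    (fun x => pow_nonneg (hq0 x) 3) hP (by fun_prop) hN
    (fun x => by simpa using (hqd x).fun_pow 2) (by simp [hql]) (by simp [hqr]) hdom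
  have hM := mass_pos 6 hA
  have key : ∀ x ∈ Icc (-R) R, 3 * κ * c ^ 2 * (q x ^ 3 * (1 + τ x ^ 2)) ≤
      (a + b) * q x ^ 2 + q x ^ 2 * (c * τ' x) := fun x hx => by
    have e : (κ * q x * (c ^ 2 * (1 + τ x ^ 2))) ^ 3 = a * b * (c * τ' x) := by
      have h1 := hkey x hx
      have h2 : √(1 + τ x ^ 2) ^ 6 = (1 + τ x ^ 2) ^ 3 := by
        rw [show 6 = 2 * 3 from rfl, pow_mul, Real.sq_sqrt (by positivity)]
      rw [h2] at h1
      have : (κ * q x * (c ^ 2 * (1 + τ x ^ 2))) ^ 3 * mass 6 A =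
          a * b * (c * τ' x) * mass 6 A := by
        calc _ = κ ^ 3 * c ^ 6 * (mass 6 A * q x ^ 3 * (1 + τ x ^ 2) ^ 3) := by ring
          _ = (κ ^ 3 * c ^ 6 * (∫ x in (-R)..R, q x ^ 3)) * τ' x := by rw [← h1]; ring
          _ = _ := by rw [h]; ring
      exact mul_right_cancel₀ hM.ne' this
    have := three_mul_le_add_of_cube_eq ha hb (mul_nonneg hc (h0 x)) e
    have := mul_le_mul_of_nonneg_left this (sq_nonneg (q x))
    linarith
  have hint := intervalIntegral.integral_mono_on (μ := volume) (by linarith : -R ≤ R)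
    ((by fun_prop : Continuous _).intervalIntegrable _ _)
    ((by fun_prop : Continuous _).intervalIntegrable _ _) key
  rw [intervalIntegral.integral_const_mul, hmom, intervalIntegral.integral_add
    ((by fun_prop : Continuous _).intervalIntegrable _ _)
    ((by fun_prop : Continuous _).intervalIntegrable _ _),
    intervalIntegral.integral_const_mul] at hint
  have := hbd c
  linarith

theorem hasDerivAt_parametric_integral {f f' : ℝ → ℝ → ℝ}
    (hf : Continuous fun w : ℝ × ℝ => f w.1 w.2) (hf' : Continuous fun w : ℝ × ℝ => f' w.1 w.2)
    (hd : ∀ y z, HasDerivAt (fun y => f y z) (f' y z) y) (a b y : ℝ) :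
    HasDerivAt (fun y => ∫ z in a..b, f y z) (∫ z in a..b, f' y z) y := by
  obtain ⟨C, hC⟩ := ((isCompact_closedBall y 1).prod
    (isCompact_uIcc (a := a) (b := b))).exists_bound_of_continuousOn hf'.continuousOn
  refine (intervalIntegral.hasDerivAt_integral_of_dominated_loc_of_deriv_le (μ := volume)
    (bound := fun _ => C) (F := f) (F' := f')
    (Metric.closedBall_mem_nhds y one_pos) ?_ ?_ ?_ ?_ ?_ ?_).2
  · exact Filter.Eventually.of_forall fun x =>
      (hf.comp (by fun_prop : Continuous fun z => (x, z))).aestronglyMeasurable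
  · exact (hf.comp (by fun_prop : Continuous fun z => (y, z))).intervalIntegrable _ _
  · exact (hf'.comp (by fun_prop : Continuous fun z => (y, z))).aestronglyMeasurable
  · exact Filter.Eventually.of_forall fun z hz x hx => hC (x, z) ⟨hx, uIoc_subset_uIcc hz⟩
  · exact intervalIntegrable_const
  · exact Filter.Eventually.of_forall fun z _ x _ => hd x z

theorem continuous_parametric_integral {X : Type*} [TopologicalSpace X] {f : X → ℝ → ℝ}
    (hf : Continuous fun w : X × ℝ => f w.1 w.2) (a b : ℝ) :
    Continuous fun x => ∫ z in a..b, f x z :=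
  intervalIntegral.continuous_parametric_intervalIntegral_of_continuous' hf a b

theorem dom_integral {R l : ℝ} (hR : 0 < R) {B' p N : ℝ → ℝ} (hB : Continuous B')
    (hp : Continuous p) (hN : Continuous N)
    (hdom : ∀ x s, -(B' x * s) ≤ 2 * l * (p x * s ^ 2) + 2 / l * N x) (s : ℝ) :
    -((∫ x in (-R)..R, B' x) * s) ≤
      2 * l * ((∫ x in (-R)..R, p x) * s ^ 2) + 2 / l * ∫ x in (-R)..R, N x := by
  rw [← intervalIntegral.integral_mul_const, ← intervalIntegral.integral_mul_const,
    ← intervalIntegral.integral_const_mul, ← intervalIntegral.integral_const_mul,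
    ← intervalIntegral.integral_neg, ← intervalIntegral.integral_add
      ((by fun_prop : Continuous _).intervalIntegrable _ _)
      ((by fun_prop : Continuous _).intervalIntegrable _ _)]
  exact intervalIntegral.integral_mono (by linarith)
    ((by fun_prop : Continuous _).intervalIntegrable _ _)
    ((by fun_prop : Continuous _).intervalIntegrable _ _) fun x => hdom x s

/-- The transport estimate in two variables, by transport of the marginal in the first one. -/
theorem transport_estimate_two {A R l : ℝ} (hA : 0 < A) (hR : 0 < R) (hl : 0 < l)
    {q q₂ q₃ N₂ N₃ : ℝ → ℝ → ℝ}
    (hq : Continuous fun w : ℝ × ℝ => q w.1 w.2) (hq₂ : Continuous fun w : ℝ × ℝ => q₂ w.1 w.2)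
    (hq₃ : Continuous fun w : ℝ × ℝ => q₃ w.1 w.2) (hN₂ : Continuous fun w : ℝ × ℝ => N₂ w.1 w.2)
    (hN₃ : Continuous fun w : ℝ × ℝ => N₃ w.1 w.2)
    (hq0 : ∀ y z, 0 ≤ q y z) (hN20 : ∀ y z, 0 ≤ N₂ y z) (hN30 : ∀ y z, 0 ≤ N₃ y z)
    (hd2 : ∀ y z, HasDerivAt (fun y => q y z) (q₂ y z) y)
    (hd3 : ∀ y z, HasDerivAt (fun z => q y z) (q₃ y z) z)
    (hyl : ∀ z, q (-R) z = 0) (hyr : ∀ z, q R z = 0)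
    (hzl : ∀ y, q y (-R) = 0) (hzr : ∀ y, q y R = 0)
    (hdom2 : ∀ y z s, -(2 * q y z * q₂ y z * s) ≤ 2 * l * (q y z ^ 3 * s ^ 2) + 2 / l * N₂ y z)
    (hdom3 : ∀ y z s, -(2 * q y z * q₃ y z * s) ≤ 2 * l * (q y z ^ 3 * s ^ 2) + 2 / l * N₃ y z)
    {κ a c : ℝ} (ha : 0 ≤ a) (hc : 0 ≤ c)
    (h : κ ^ 3 * c ^ 4 * (∫ y in (-R)..R, ∫ z in (-R)..R, q y z ^ 3) =
      a * mass 5 A * mass 6 A) :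
    3 * κ * c ^ 2 * (moment 5 A * moment 6 A) * (∫ y in (-R)..R, ∫ z in (-R)..R, q y z ^ 3) ≤
      a * (∫ y in (-R)..R, ∫ z in (-R)..R, q y z ^ 2) +
      2 * l * c ^ 2 * (moment 5 A * moment 6 A - 1) *
        (∫ y in (-R)..R, ∫ z in (-R)..R, q y z ^ 3) +
      2 / l * ((∫ y in (-R)..R, ∫ z in (-R)..R, N₂ y z) +
        ∫ y in (-R)..R, ∫ z in (-R)..R, N₃ y z) := by
  have sec : ∀ {f : ℝ → ℝ → ℝ}, (Continuous fun w : ℝ × ℝ => f w.1 w.2) → ∀ y, Continuous (f y) :=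
    fun hf y => hf.comp (by fun_prop : Continuous fun z => (y, z))
  have hN2c := continuous_parametric_integral hN₂ (-R) R
  have hN3c := continuous_parametric_integral hN₃ (-R) R
  have hpc : Continuous fun y => ∫ z in (-R)..R, q y z ^ 3 :=
    continuous_parametric_integral (hq.pow 3) (-R) R
  have hBc : Continuous fun y => ∫ z in (-R)..R, q y z ^ 2 :=
    continuous_parametric_integral (hq.pow 2) (-R) R
  have hBc' : Continuous fun y => ∫ z in (-R)..R, 2 * q y z * q₂ y z :=
    continuous_parametric_integral (by fun_prop) (-R) R
  have hN2' := fun y => intervalIntegral_nonneg hR (hN20 y)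
  have hN3' := fun y => intervalIntegral_nonneg hR (hN30 y)
  have hp' := fun y => intervalIntegral_nonneg hR fun z => pow_nonneg (hq0 y z) 3
  have hB2' := fun y => intervalIntegral_nonneg hR fun z => sq_nonneg (q y z)
  have hN2'' := intervalIntegral_nonneg hR hN2'
  have hN3'' := intervalIntegral_nonneg hR hN3'
  have hB2'' := intervalIntegral_nonneg hR hB2'
  rcases (intervalIntegral_nonneg hR hp').eq_or_lt with hP | hP
  · rw [← hP]; simp only [mul_zero, add_zero]; positivity
  obtain ⟨τ, τ', hτ, hτ', h0, hkey, hmom, hbd⟩ := exists_transport_prof 5 hA hR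
    (p := fun y => ∫ z in (-R)..R, q y z ^ 3) (B := fun y => ∫ z in (-R)..R, q y z ^ 2)
    (B' := fun y => ∫ z in (-R)..R, 2 * q y z * q₂ y z) (l := l) hpc hp' hP hBc' hN2c
    (hasDerivAt_parametric_integral (hq.pow 2) (by fun_prop)
      (fun y z => by simpa using (hd2 y z).fun_pow 2) (-R) R)
    (by simp [hyl]) (by simp [hyr])
    (fun y => dom_integral hR (sec (f := fun y z => 2 * q y z * q₂ y z) (by fun_prop) y)
      ((sec hq y).pow 3) (sec hN₂ y) (hdom2 y))
  set P := ∫ y in (-R)..R, ∫ z in (-R)..R, q y z ^ 3 with hPd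
  have key : ∀ y ∈ Icc (-R) R,
      (3 * κ * c ^ 2 * moment 6 A) * ((∫ z in (-R)..R, q y z ^ 3) * (1 + τ y ^ 2)) ≤
      a * (∫ z in (-R)..R, q y z ^ 2) + (∫ z in (-R)..R, q y z ^ 2) * (c * τ' y) +
      (2 * l * c ^ 2 * (moment 6 A - 1)) * ((∫ z in (-R)..R, q y z ^ 3) * (1 + τ y ^ 2)) +
      2 / l * ∫ z in (-R)..R, N₃ y z := fun y hy => by
    set s := √(1 + τ y ^ 2) with hs
    have hs2 : s ^ 2 = 1 + τ y ^ 2 := Real.sq_sqrt (by positivity)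
    have hs0 : 0 ≤ s := Real.sqrt_nonneg _
    have := transport_estimate_one hA hR hl (sec hq y) (sec hq₃ y) (sec hN₃ y)
      (hq0 y) (hN30 y) (hd3 y) (hzl y) (hzr y) (hdom3 y) (κ := κ) ha
      (mul_nonneg hc (h0 y)) (mul_nonneg hc hs0) (by
        refine mul_right_cancel₀ hP.ne' ?_
        calc _ = (κ ^ 3 * c ^ 4 * P) * c ^ 2 * s ^ 6 * ∫ z in (-R)..R, q y z ^ 3 := by ring
          _ = a * c ^ 2 * mass 6 A * s * (mass 5 A * (∫ z in (-R)..R, q y z ^ 3) * s ^ 5) := by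
            rw [h]; ring
          _ = _ := by rw [← hkey y hy]; ring)
    rw [← hs2]
    linarith
  have hint := intervalIntegral.integral_mono_on (μ := volume) (by linarith : -R ≤ R)
    ((by fun_prop : Continuous _).intervalIntegrable _ _)
    ((by fun_prop : Continuous _).intervalIntegrable _ _) key
  rw [intervalIntegral.integral_const_mul, hmom, intervalIntegral.integral_add
    ((by fun_prop : Continuous _).intervalIntegrable _ _)
    ((by fun_prop : Continuous _).intervalIntegrable _ _), intervalIntegral.integral_add
    ((by fun_prop : Continuous _).intervalIntegrable _ _)
    ((by fun_prop : Continuous _).intervalIntegrable _ _), intervalIntegral.integral_add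
    ((by fun_prop : Continuous _).intervalIntegrable _ _)
    ((by fun_prop : Continuous _).intervalIntegrable _ _),
    intervalIntegral.integral_const_mul, intervalIntegral.integral_const_mul,
    intervalIntegral.integral_const_mul, hmom] at hint
  have := hbd c
  linarith

/-- The transport estimate in three variables, by transport of the marginal in the first one. -/
theorem transport_estimate_three {A R l : ℝ} (hA : 0 < A) (hR : 0 < R) (hl : 0 < l)
    {q q₁ q₂ q₃ N₁ N₂ N₃ : ℝ → ℝ → ℝ → ℝ}
    (hq : Continuous fun w : ℝ × ℝ × ℝ => q w.1 w.2.1 w.2.2)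
    (hq₁ : Continuous fun w : ℝ × ℝ × ℝ => q₁ w.1 w.2.1 w.2.2)
    (hq₂ : Continuous fun w : ℝ × ℝ × ℝ => q₂ w.1 w.2.1 w.2.2)
    (hq₃ : Continuous fun w : ℝ × ℝ × ℝ => q₃ w.1 w.2.1 w.2.2)
    (hN₁ : Continuous fun w : ℝ × ℝ × ℝ => N₁ w.1 w.2.1 w.2.2)
    (hN₂ : Continuous fun w : ℝ × ℝ × ℝ => N₂ w.1 w.2.1 w.2.2)
    (hN₃ : Continuous fun w : ℝ × ℝ × ℝ => N₃ w.1 w.2.1 w.2.2)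
    (hq0 : ∀ x y z, 0 ≤ q x y z)
    (hN20 : ∀ x y z, 0 ≤ N₂ x y z) (hN30 : ∀ x y z, 0 ≤ N₃ x y z)
    (hd1 : ∀ x y z, HasDerivAt (fun x => q x y z) (q₁ x y z) x)
    (hd2 : ∀ x y z, HasDerivAt (fun y => q x y z) (q₂ x y z) y)
    (hd3 : ∀ x y z, HasDerivAt (fun z => q x y z) (q₃ x y z) z)
    (hxl : ∀ y z, q (-R) y z = 0) (hxr : ∀ y z, q R y z = 0)
    (hyl : ∀ x z, q x (-R) z = 0) (hyr : ∀ x z, q x R z = 0)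
    (hzl : ∀ x y, q x y (-R) = 0) (hzr : ∀ x y, q x y R = 0)
    (hdom1 : ∀ x y z s, -(2 * q x y z * q₁ x y z * s) ≤
      2 * l * (q x y z ^ 3 * s ^ 2) + 2 / l * N₁ x y z)
    (hdom2 : ∀ x y z s, -(2 * q x y z * q₂ x y z * s) ≤
      2 * l * (q x y z ^ 3 * s ^ 2) + 2 / l * N₂ x y z)
    (hdom3 : ∀ x y z s, -(2 * q x y z * q₃ x y z * s) ≤
      2 * l * (q x y z ^ 3 * s ^ 2) + 2 / l * N₃ x y z)
    (hP : 0 < ∫ x in (-R)..R, ∫ y in (-R)..R, ∫ z in (-R)..R, q x y z ^ 3) {κ : ℝ}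
    (h : κ ^ 3 * (∫ x in (-R)..R, ∫ y in (-R)..R, ∫ z in (-R)..R, q x y z ^ 3) =
      mass 4 A * mass 5 A * mass 6 A) :
    3 * κ * (moment 4 A * moment 5 A * moment 6 A) *
      (∫ x in (-R)..R, ∫ y in (-R)..R, ∫ z in (-R)..R, q x y z ^ 3) ≤
      2 * l * (moment 4 A * moment 5 A * moment 6 A - 1) *
        (∫ x in (-R)..R, ∫ y in (-R)..R, ∫ z in (-R)..R, q x y z ^ 3) +
      2 / l * ((∫ x in (-R)..R, ∫ y in (-R)..R, ∫ z in (-R)..R, N₁ x y z) +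
        (∫ x in (-R)..R, ∫ y in (-R)..R, ∫ z in (-R)..R, N₂ x y z) +
        ∫ x in (-R)..R, ∫ y in (-R)..R, ∫ z in (-R)..R, N₃ x y z) := by
  have sec : ∀ {f : ℝ → ℝ → ℝ → ℝ}, (Continuous fun w : ℝ × ℝ × ℝ => f w.1 w.2.1 w.2.2) →
      ∀ x, Continuous fun w : ℝ × ℝ => f x w.1 w.2 :=
    fun hf x => hf.comp (by fun_prop : Continuous fun w : ℝ × ℝ => (x, w.1, w.2))
  have inner : ∀ {f : ℝ → ℝ → ℝ → ℝ}, (Continuous fun w : ℝ × ℝ × ℝ => f w.1 w.2.1 w.2.2) →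
      Continuous fun w : ℝ × ℝ => ∫ z in (-R)..R, f w.1 w.2 z := fun {f} hf =>
    continuous_parametric_integral (f := fun (w : ℝ × ℝ) z => f w.1 w.2 z)
      (hf.comp (by fun_prop : Continuous fun w : (ℝ × ℝ) × ℝ => (w.1.1, w.1.2, w.2))) _ _
  have outer : ∀ {f : ℝ → ℝ → ℝ → ℝ}, (Continuous fun w : ℝ × ℝ × ℝ => f w.1 w.2.1 w.2.2) →
      Continuous fun x => ∫ y in (-R)..R, ∫ z in (-R)..R, f x y z := fun hf =>
    continuous_parametric_integral (inner hf) _ _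
  have hq1' : Continuous fun w : ℝ × ℝ × ℝ => 2 * q w.1 w.2.1 w.2.2 * q₁ w.1 w.2.1 w.2.2 := by
    fun_prop
  have hN1c := outer hN₁
  have hN2c := outer hN₂
  have hN3c := outer hN₃
  have hpc := outer (f := fun x y z => q x y z ^ 3) (hq.pow 3)
  have hBc := outer (f := fun x y z => q x y z ^ 2) (hq.pow 2)
  obtain ⟨τ, τ', hτ, hτ', h0, hkey, hmom, hbd⟩ := exists_transport_prof 4 hA hR
    (p := fun x => ∫ y in (-R)..R, ∫ z in (-R)..R, q x y z ^ 3)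
    (B := fun x => ∫ y in (-R)..R, ∫ z in (-R)..R, q x y z ^ 2)
    (B' := fun x => ∫ y in (-R)..R, ∫ z in (-R)..R, 2 * q x y z * q₁ x y z) (l := l) hpc
    (fun x => intervalIntegral_nonneg hR fun y => intervalIntegral_nonneg hR fun z =>
      pow_nonneg (hq0 x y z) 3) hP
    (outer (f := fun x y z => 2 * q x y z * q₁ x y z) hq1') hN1c
    (hasDerivAt_parametric_integral
      (inner (f := fun x y z => q x y z ^ 2) (hq.pow 2))
      (inner (f := fun x y z => 2 * q x y z * q₁ x y z) hq1')
      (fun x y => hasDerivAt_parametric_integral (f := fun x z => q x y z ^ 2)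
        (f' := fun x z => 2 * q x y z * q₁ x y z)
        ((hq.pow 2).comp (by fun_prop : Continuous fun w : ℝ × ℝ => (w.1, y, w.2)))
        (hq1'.comp (by fun_prop : Continuous fun w : ℝ × ℝ => (w.1, y, w.2)))
        (fun x z => by simpa using (hd1 x y z).fun_pow 2) _ _ x) (-R) R)
    (by simp [hxl]) (by simp [hxr])
    (fun x => dom_integral hR
      (continuous_parametric_integral (sec (f := fun x y z => 2 * q x y z * q₁ x y z) hq1' x) _ _)
      (continuous_parametric_integral (sec (f := fun x y z => q x y z ^ 3) (hq.pow 3) x) _ _)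
      (continuous_parametric_integral (sec hN₁ x) _ _)
      fun y => dom_integral hR
        ((sec (f := fun x y z => 2 * q x y z * q₁ x y z) hq1' x).comp
          (by fun_prop : Continuous fun z => (y, z)))
        (((sec hq x).comp (by fun_prop : Continuous fun z => (y, z))).pow 3)
        ((sec hN₁ x).comp (by fun_prop : Continuous fun z => (y, z))) (hdom1 x y))
  set P := ∫ x in (-R)..R, ∫ y in (-R)..R, ∫ z in (-R)..R, q x y z ^ 3 with hPd
  set m := moment 5 A * moment 6 A with hm
  have key : ∀ x ∈ Icc (-R) R,
      (3 * κ * m) * ((∫ y in (-R)..R, ∫ z in (-R)..R, q x y z ^ 3) * (1 + τ x ^ 2)) ≤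
      (∫ y in (-R)..R, ∫ z in (-R)..R, q x y z ^ 2) * (1 * τ' x) +
      (2 * l * (m - 1)) *
        ((∫ y in (-R)..R, ∫ z in (-R)..R, q x y z ^ 3) * (1 + τ x ^ 2)) +
      2 / l * ((∫ y in (-R)..R, ∫ z in (-R)..R, N₂ x y z) +
        ∫ y in (-R)..R, ∫ z in (-R)..R, N₃ x y z) := fun x hx => by
    set s := √(1 + τ x ^ 2) with hs
    have hs2 : s ^ 2 = 1 + τ x ^ 2 := Real.sq_sqrt (by positivity)
    have hs0 : 0 ≤ s := Real.sqrt_nonneg _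
    have := transport_estimate_two hA hR hl (sec hq x) (sec hq₂ x) (sec hq₃ x)
      (sec hN₂ x) (sec hN₃ x)
      (hq0 x) (hN20 x) (hN30 x) (hd2 x) (hd3 x) (hyl x) (hyr x) (hzl x) (hzr x) (hdom2 x)
      (hdom3 x) (κ := κ) (h0 x) hs0 (by
        refine mul_right_cancel₀ hP.ne' ?_
        calc _ = (κ ^ 3 * P) * s ^ 4 * ∫ y in (-R)..R, ∫ z in (-R)..R, q x y z ^ 3 := by ring
          _ = mass 5 A * mass 6 A *
            (mass 4 A * (∫ y in (-R)..R, ∫ z in (-R)..R, q x y z ^ 3) * s ^ 4) := by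
            rw [h]; ring
          _ = _ := by rw [← hkey x hx]; ring)
    rw [← hs2]
    linarith
  have hint := intervalIntegral.integral_mono_on (μ := volume) (by linarith : -R ≤ R)
    ((by fun_prop : Continuous _).intervalIntegrable _ _)
    ((by fun_prop : Continuous _).intervalIntegrable _ _) key
  rw [intervalIntegral.integral_const_mul, hmom, intervalIntegral.integral_add
    ((by fun_prop : Continuous _).intervalIntegrable _ _)
    ((by fun_prop : Continuous _).intervalIntegrable _ _), intervalIntegral.integral_add
    ((by fun_prop : Continuous _).intervalIntegrable _ _)
    ((by fun_prop : Continuous _).intervalIntegrable _ _),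
    intervalIntegral.integral_const_mul, intervalIntegral.integral_const_mul, hmom,
    intervalIntegral.integral_add
    ((by fun_prop : Continuous _).intervalIntegrable _ _)
    ((by fun_prop : Continuous _).intervalIntegrable _ _)] at hint
  have := hbd 1
  linear_combination hint + this

theorem neg_mul_le_of_sq_le {l q d N s : ℝ} (hl : 0 < l) (hq : 0 ≤ q)
    (h : d ^ 2 ≤ 4 * q * N) (hN : 0 ≤ N) :
    -(2 * q * d * s) ≤ 2 * l * (q ^ 3 * s ^ 2) + 2 / l * N := by
  have h1 : (2 * q * d * s) ^ 2 ≤ (2 * l * (q ^ 3 * s ^ 2) + 2 / l * N) ^ 2 := by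
    have e : (2 * l * (q ^ 3 * s ^ 2) + 2 / l * N) ^ 2 =
        (2 * l * (q ^ 3 * s ^ 2) - 2 / l * N) ^ 2 + 16 * q ^ 3 * s ^ 2 * N := by
      field_simp; ring
    have := mul_le_mul_of_nonneg_left h (by positivity : 0 ≤ 4 * q ^ 2 * s ^ 2)
    nlinarith [sq_nonneg (2 * l * (q ^ 3 * s ^ 2) - 2 / l * N)]
  linarith [neg_le_of_abs_le (abs_le_of_sq_le_sq h1 (by positivity))]

/-- With the optimal choice of the weight, the transport estimate becomes scale free. -/
theorem cube_bound {κ w P D Z : ℝ} (hκ : 0 < κ) (hP : 0 < P) (hw : 0 ≤ w + 2)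
    (hZ : κ ^ 3 * P = Z) (h : 3 * κ * w * P ≤ 2 * κ * (w - 1) * P + 2 / κ * D) :
    (w + 2) ^ 3 * Z ^ 2 * P ≤ 8 * D ^ 3 := by
  have h1 : (w + 2) * κ ^ 2 * P ≤ 2 * D := by
    have := mul_le_mul_of_nonneg_left h hκ.le
    have e : κ * (2 * κ * (w - 1) * P + 2 / κ * D) = 2 * κ ^ 2 * (w - 1) * P + 2 * D := by
      field_simp
    rw [e] at this
    linarith
  have := pow_le_pow_left₀ (by positivity) h1 3
  rw [← hZ]
  linarith

open Filter Topology in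
theorem tendsto_one_add_sq_sqrt : Tendsto (fun A : ℝ => √(1 + A ^ 2)) atTop atTop := by
  refine tendsto_atTop_mono (fun A => ?_) tendsto_id
  exact Real.le_sqrt_of_sq_le (by simp)

theorem hasDerivAt_sqrt_one_add_sq (t : ℝ) :
    HasDerivAt (fun t => √(1 + t ^ 2)) (t / √(1 + t ^ 2)) t := by
  have h : HasDerivAt (fun t : ℝ => 1 + t ^ 2) (2 * t) t := by
    simpa using (hasDerivAt_pow 2 t).const_add 1
  convert h.sqrt (by positivity) using 1
  field_simp

/-- The reduction formula between `mass (k + 2)` and `mass k`. -/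
theorem mass_add_two {k : ℕ} (A : ℝ) :
    (k : ℝ) * mass (k + 2) A = (k - 1) * mass k A + 2 * A / √(1 + A ^ 2) ^ k := by
  have hd : ∀ t : ℝ, HasDerivAt (fun t => t * prof k t)
      (k * prof (k + 2) t - (k - 1) * prof k t) t := fun t => by
    have hs := sqrt_one_add_sq_pos t
    have hs2 : √(1 + t ^ 2) ^ 2 = 1 + t ^ 2 := Real.sq_sqrt (by positivity)
    refine ((hasDerivAt_id t).fun_mul
      (((hasDerivAt_sqrt_one_add_sq t).fun_pow k).fun_inv (pow_pos hs k).ne')).congr_deriv ?_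
    unfold prof
    generalize √(1 + t ^ 2) = s at *
    have ht : t ^ 2 = s ^ 2 - 1 := by linarith
    rcases k with _ | k
    · simp
    · simp only [id, Nat.add_sub_cancel, one_mul]
      field_simp
      rw [ht]; push_cast; ring
  have := intervalIntegral.integral_eq_sub_of_hasDerivAt (a := -A) (b := A) (fun t _ => hd t)
    (((continuous_prof (k + 2)).const_mul _ |>.sub
      ((continuous_prof k).const_mul _)).intervalIntegrable _ _)
  rw [intervalIntegral.integral_sub
    (((continuous_prof (k + 2)).const_mul _).intervalIntegrable _ _)
    (((continuous_prof k).const_mul _).intervalIntegrable _ _),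
    intervalIntegral.integral_const_mul, intervalIntegral.integral_const_mul] at this
  have e : prof k (-A) = prof k A := by simp [prof]
  rw [e] at this
  have e2 : prof k A = 1 / √(1 + A ^ 2) ^ k := by simp [prof]
  rw [e2] at this
  unfold mass
  linear_combination this

theorem moment_add_two (k : ℕ) (A : ℝ) : moment (k + 2) A = mass k A / mass (k + 2) A := by
  unfold moment
  congr 1
  refine intervalIntegral.integral_congr fun t _ => ?_
  have hs := sqrt_one_add_sq_pos t
  have hs2 : √(1 + t ^ 2) ^ 2 = 1 + t ^ 2 := Real.sq_sqrt (by positivity)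
  simp only [prof, pow_add, hs2]
  field_simp

open Filter Topology in
theorem tendsto_div_sqrt_one_add_sq :
    Tendsto (fun A : ℝ => A / √(1 + A ^ 2)) atTop (𝓝 1) := by
  have := (Real.continuous_sin.tendsto (π / 2)).comp
    (tendsto_nhds_of_tendsto_nhdsWithin Real.tendsto_arctan_atTop)
  rw [Real.sin_pi_div_two] at this
  exact this.congr fun A => by simp [Real.sin_arctan]

open Filter Topology in
theorem tendsto_two_mul_div_sqrt_pow {k : ℕ} (hk : k ≠ 0) :
    Tendsto (fun A : ℝ => 2 * A / √(1 + A ^ 2) ^ (k + 1)) atTop (𝓝 0) := by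
  have h := tendsto_div_sqrt_one_add_sq.mul
    (tendsto_inv_atTop_zero.comp ((tendsto_pow_atTop hk).comp tendsto_one_add_sq_sqrt))
  have h2 := h.const_mul 2
  simp only [mul_zero] at h2
  refine h2.congr fun A => ?_
  have := (sqrt_one_add_sq_pos A).ne'
  simp only [Function.comp]
  field_simp
  ring

open Filter Topology in
theorem tendsto_mass_two : Tendsto (mass 2) atTop (𝓝 π) := by
  have h : ∀ A, mass 2 A = 2 * arctan A := fun A => by
    have : ∀ t, prof 2 t = (1 + t ^ 2)⁻¹ := fun t => by
      rw [prof, Real.sq_sqrt (by positivity)]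
    simp only [mass, this, integral_inv_one_add_sq, Real.arctan_neg]
    ring
  have := (tendsto_nhds_of_tendsto_nhdsWithin Real.tendsto_arctan_atTop).const_mul 2
  rw [mul_div_cancel₀ _ two_ne_zero] at this
  exact this.congr fun A => (h A).symm

open Filter Topology in
theorem tendsto_mass_add_two {k : ℕ} (hk : 2 ≤ k) {m : ℝ} (h : Tendsto (mass k) atTop (𝓝 m)) :
    Tendsto (mass (k + 2)) atTop (𝓝 ((k - 1) * m / k)) := by
  obtain ⟨j, rfl⟩ : ∃ j, k = j + 1 := ⟨k - 1, by omega⟩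
  have := ((h.const_mul (((j + 1 : ℕ) : ℝ) - 1)).add
    (tendsto_two_mul_div_sqrt_pow (k := j) (by omega))).div_const ((j + 1 : ℕ) : ℝ)
  rw [add_zero] at this
  refine this.congr fun A => ?_
  rw [← mass_add_two]
  field_simp

open Filter Topology in
theorem tendsto_mass_three : Tendsto (mass 3) atTop (𝓝 2) := by
  have h := tendsto_div_sqrt_one_add_sq.const_mul 2
  rw [mul_one] at h
  refine h.congr fun A => ?_
  have := mass_add_two (k := 1) A
  norm_num at this
  rw [this]; ring

open Filter Topology in
theorem tendsto_mass_prod :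
    Tendsto (fun A => mass 4 A * mass 5 A * mass 6 A) atTop (𝓝 (π ^ 2 / 4)) := by
  have h4 := tendsto_mass_add_two le_rfl tendsto_mass_two
  have h5 := tendsto_mass_add_two (by norm_num) tendsto_mass_three
  have h6 := tendsto_mass_add_two (by norm_num) h4
  convert (h4.mul h5).mul h6 using 2
  push_cast; ring

open Filter Topology in
theorem tendsto_moment_prod :
    Tendsto (fun A => moment 4 A * moment 5 A * moment 6 A) atTop (𝓝 4) := by
  have h4 := tendsto_mass_add_two le_rfl tendsto_mass_two
  have h5 := tendsto_mass_add_two (by norm_num) tendsto_mass_three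
  have h6 := tendsto_mass_add_two (by norm_num) h4
  have hπ := Real.pi_pos.ne'
  simp only [moment_add_two]
  convert ((tendsto_mass_two.div h4 (by norm_num [hπ])).mul
    (tendsto_mass_three.div h5 (by norm_num))).mul (h4.div h6 (by norm_num [hπ])) using 2
  · simp only [Pi.div_apply]
  · push_cast; field_simp; norm_num

theorem moment_nonneg (k : ℕ) {A : ℝ} (hA : 0 < A) : 0 ≤ moment k A :=
  div_nonneg (intervalIntegral_nonneg hA fun t => mul_nonneg (prof_pos k t).le (by positivity))
    (mass_pos k hA).le

/-- The sharp Sobolev inequality for `√q`, where `q ≥ 0` is supported in a cube and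
`N i` dominates the square of the `i`-th partial derivative of `√q`. -/
theorem sobolev_cube {R : ℝ} (hR : 0 < R)
    {q q₁ q₂ q₃ N₁ N₂ N₃ : ℝ → ℝ → ℝ → ℝ}
    (hq : Continuous fun w : ℝ × ℝ × ℝ => q w.1 w.2.1 w.2.2)
    (hq₁ : Continuous fun w : ℝ × ℝ × ℝ => q₁ w.1 w.2.1 w.2.2)
    (hq₂ : Continuous fun w : ℝ × ℝ × ℝ => q₂ w.1 w.2.1 w.2.2)
    (hq₃ : Continuous fun w : ℝ × ℝ × ℝ => q₃ w.1 w.2.1 w.2.2)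
    (hN₁ : Continuous fun w : ℝ × ℝ × ℝ => N₁ w.1 w.2.1 w.2.2)
    (hN₂ : Continuous fun w : ℝ × ℝ × ℝ => N₂ w.1 w.2.1 w.2.2)
    (hN₃ : Continuous fun w : ℝ × ℝ × ℝ => N₃ w.1 w.2.1 w.2.2)
    (hq0 : ∀ x y z, 0 ≤ q x y z) (hN10 : ∀ x y z, 0 ≤ N₁ x y z)
    (hN20 : ∀ x y z, 0 ≤ N₂ x y z) (hN30 : ∀ x y z, 0 ≤ N₃ x y z)
    (hd1 : ∀ x y z, HasDerivAt (fun x => q x y z) (q₁ x y z) x)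
    (hd2 : ∀ x y z, HasDerivAt (fun y => q x y z) (q₂ x y z) y)
    (hd3 : ∀ x y z, HasDerivAt (fun z => q x y z) (q₃ x y z) z)
    (hxl : ∀ y z, q (-R) y z = 0) (hxr : ∀ y z, q R y z = 0)
    (hyl : ∀ x z, q x (-R) z = 0) (hyr : ∀ x z, q x R z = 0)
    (hzl : ∀ x y, q x y (-R) = 0) (hzr : ∀ x y, q x y R = 0)
    (h1 : ∀ x y z, q₁ x y z ^ 2 ≤ 4 * q x y z * N₁ x y z)
    (h2 : ∀ x y z, q₂ x y z ^ 2 ≤ 4 * q x y z * N₂ x y z)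
    (h3 : ∀ x y z, q₃ x y z ^ 2 ≤ 4 * q x y z * N₃ x y z) :
    27 * π ^ 4 * (∫ x in (-R)..R, ∫ y in (-R)..R, ∫ z in (-R)..R, q x y z ^ 3) ≤
      16 * ((∫ x in (-R)..R, ∫ y in (-R)..R, ∫ z in (-R)..R, N₁ x y z) +
        (∫ x in (-R)..R, ∫ y in (-R)..R, ∫ z in (-R)..R, N₂ x y z) +
        ∫ x in (-R)..R, ∫ y in (-R)..R, ∫ z in (-R)..R, N₃ x y z) ^ 3 := by
  have nn : ∀ {f : ℝ → ℝ → ℝ → ℝ}, (∀ x y z, 0 ≤ f x y z) →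
      0 ≤ ∫ x in (-R)..R, ∫ y in (-R)..R, ∫ z in (-R)..R, f x y z := fun hf =>
    intervalIntegral_nonneg hR fun x => intervalIntegral_nonneg hR fun y =>
      intervalIntegral_nonneg hR fun z => hf x y z
  have n1 := nn hN10
  have n2 := nn hN20
  have n3 := nn hN30
  rcases (nn fun x y z => pow_nonneg (hq0 x y z) 3).eq_or_lt with hP | hP
  · rw [← hP, mul_zero]; positivity
  have main : ∀ A : ℝ, 0 < A → _ := fun A hA => by
    have hZ : 0 < mass 4 A * mass 5 A * mass 6 A :=
      mul_pos (mul_pos (mass_pos 4 hA) (mass_pos 5 hA)) (mass_pos 6 hA)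
    have hκ := Real.rpow_pos_of_pos (div_pos hZ hP) (1 / 3)
    have hκ3 := Real.rpow_inv_natCast_pow (div_pos hZ hP).le (three_ne_zero)
    rw [show ((3 : ℕ) : ℝ)⁻¹ = 1 / 3 by norm_num] at hκ3
    have h := (div_eq_iff hP.ne').1 hκ3.symm
    have hw : 0 ≤ moment 4 A * moment 5 A * moment 6 A :=
      mul_nonneg (mul_nonneg (moment_nonneg 4 hA) (moment_nonneg 5 hA)) (moment_nonneg 6 hA)
    exact cube_bound hκ hP (by linarith) h.symm (transport_estimate_three hA hR hκ
      hq hq₁ hq₂ hq₃ hN₁ hN₂ hN₃ hq0 hN20 hN30 hd1 hd2 hd3 hxl hxr hyl hyr hzl hzr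
      (fun x y z s => neg_mul_le_of_sq_le hκ (hq0 x y z) (h1 x y z) (hN10 x y z))
      (fun x y z s => neg_mul_le_of_sq_le hκ (hq0 x y z) (h2 x y z) (hN20 x y z))
      (fun x y z s => neg_mul_le_of_sq_le hκ (hq0 x y z) (h3 x y z) (hN30 x y z)) hP h.symm)
  have hlim := le_of_tendsto ((((tendsto_moment_prod.add_const 2).pow 3).mul
    (tendsto_mass_prod.pow 2)).mul_const _)
    ((Filter.eventually_gt_atTop 0).mono main)
  linarith

/-- The point of ℝ³ with coordinates `x, y, z`. -/
def pt (x y z : ℝ) : E3 := x • e3 0 + y • e3 1 + z • e3 2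

theorem pt_apply (x y z : ℝ) : pt x y z 0 = x ∧ pt x y z 1 = y ∧ pt x y z 2 = z := by
  simp [pt, e3]

/-- Cartesian coordinates on ℝ³ as a measurable equivalence. -/
def ptEquiv : ℝ × ℝ × ℝ ≃ᵐ E3 :=
  ((MeasurableEquiv.prodCongr (MeasurableEquiv.refl ℝ) MeasurableEquiv.finTwoArrow.symm).trans
    (MeasurableEquiv.piFinSuccAbove (fun _ : Fin 3 => ℝ) 0).symm).trans
    (MeasurableEquiv.toLp 2 (Fin 3 → ℝ))

theorem ptEquiv_apply (w : ℝ × ℝ × ℝ) : ptEquiv w = pt w.1 w.2.1 w.2.2 := by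
  obtain ⟨h0, h1, h2⟩ := pt_apply w.1 w.2.1 w.2.2
  ext i
  fin_cases i
  · exact h0.symm
  · exact h1.symm
  · exact h2.symm

theorem measurePreserving_ptEquiv : MeasurePreserving ptEquiv := by
  refine (PiLp.volume_preserving_toLp (Fin 3)).comp
    (((volume_preserving_piFinSuccAbove (fun _ : Fin 3 => ℝ) 0).symm).comp ?_)
  exact (MeasurePreserving.id volume).prod (volume_preserving_finTwoArrow ℝ).symm

theorem continuous_pt : Continuous fun w : ℝ × ℝ × ℝ => pt w.1 w.2.1 w.2.2 := by
  unfold pt; fun_prop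

theorem abs_coord_le_norm_pt (x y z : ℝ) :
    |x| ≤ ‖pt x y z‖ ∧ |y| ≤ ‖pt x y z‖ ∧ |z| ≤ ‖pt x y z‖ := by
  obtain ⟨h0, h1, h2⟩ := pt_apply x y z
  refine ⟨?_, ?_, ?_⟩
  · simpa [h0] using PiLp.norm_apply_le (pt x y z) 0
  · simpa [h1] using PiLp.norm_apply_le (pt x y z) 1
  · simpa [h2] using PiLp.norm_apply_le (pt x y z) 2

theorem integral_eq_intervalIntegral {R : ℝ} {f : ℝ → ℝ} (hf : ∀ x, R ≤ |x| → f x = 0) :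
    ∫ x, f x = ∫ x in (-R)..R, f x := by
  refine (intervalIntegral.integral_eq_integral_of_support_subset fun x hx => ?_).symm
  by_contra h
  refine hx (hf x ?_)
  by_contra! h2
  exact h ⟨(abs_lt.1 h2).1, (abs_lt.1 h2).2.le⟩

theorem integral_E3 {R : ℝ} {g : E3 → ℝ} (hg : Continuous g) (hz : ∀ x, R ≤ ‖x‖ → g x = 0) :
    ∫ x, g x = ∫ x in (-R)..R, ∫ y in (-R)..R, ∫ z in (-R)..R, g (pt x y z) := by
  have hcs : HasCompactSupport g :=
    HasCompactSupport.of_support_subset_isCompact (isCompact_closedBall 0 R) fun x hx => by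
      rw [mem_closedBall_zero_iff]
      by_contra! h
      exact hx (hz x h.le)
  have hint := (measurePreserving_ptEquiv.integrable_comp_emb
    ptEquiv.measurableEmbedding).2 (hg.integrable_of_hasCompactSupport hcs)
  have e : g ∘ ptEquiv = fun w => g (pt w.1 w.2.1 w.2.2) := funext fun w => by
    simp [ptEquiv_apply]
  rw [e, Measure.volume_eq_prod] at hint
  rw [← measurePreserving_ptEquiv.integral_comp' g]
  simp only [ptEquiv_apply]
  rw [Measure.volume_eq_prod, integral_prod _ hint]
  have hae : ∀ᵐ x : ℝ, ∫ w : ℝ × ℝ, g (pt x w.1 w.2) =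
      ∫ y in (-R)..R, ∫ z in (-R)..R, g (pt x y z) := by
    filter_upwards [hint.prod_right_ae] with x hx
    rw [Measure.volume_eq_prod] at hx ⊢
    rw [integral_prod _ hx]
    have : ∀ y, ∫ z, g (pt x y z) = ∫ z in (-R)..R, g (pt x y z) := fun y =>
      integral_eq_intervalIntegral fun z hR => hz _ (hR.trans (abs_coord_le_norm_pt x y z).2.2)
    simp only [this]
    refine integral_eq_intervalIntegral fun y hR => ?_
    simp [hz _ (hR.trans (abs_coord_le_norm_pt x y _).2.1)]
  rw [integral_congr_ae hae]
  refine integral_eq_intervalIntegral fun x hR => ?_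
  simp [hz _ (hR.trans (abs_coord_le_norm_pt x _ _).1)]

theorem sobolev_integral (u : E3 → E3) (hu : ContDiff ℝ (⊤ : ℕ∞) u) (hcs : HasCompactSupport u) :
    27 * π ^ 4 * (∫ x : E3, ‖u x‖ ^ 6) ≤ 16 * (∫ x : E3, gradSqV u x) ^ 3 := by
  obtain ⟨R, hR, hsub⟩ := hcs.isCompact.isBounded.subset_ball_lt 0 (0 : E3)
  have hout : ∀ x, R ≤ ‖x‖ → x ∉ tsupport u := fun x hx h => by
    have := hsub h
    rw [mem_ball_zero_iff] at this
    linarith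
  have hu0 : ∀ x, R ≤ ‖x‖ → u x = 0 := fun x hx => image_eq_zero_of_notMem_tsupport (hout x hx)
  have hpd0 : ∀ i x, R ≤ ‖x‖ → pd i u x = 0 := fun i x hx => by
    have : fderiv ℝ u x = 0 := by
      by_contra h
      exact hout x hx (support_fderiv_subset ℝ h)
    simp [pd, this]
  have huc : Continuous u := hu.continuous
  have hpdc : ∀ i, Continuous (pd i u) := fun i =>
    (hu.continuous_fderiv (by simp)).clm_apply continuous_const
  have hd : ∀ (i : Fin 3) (t : ℝ) (a : E3), HasDerivAt (fun t : ℝ => ‖u (t • e3 i + a)‖ ^ 2)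
      (2 * inner ℝ (u (t • e3 i + a)) (pd i u (t • e3 i + a))) t := fun i t a => by
    have h1 : HasDerivAt (fun t : ℝ => t • e3 i + a) (e3 i) t := by
      simpa using ((hasDerivAt_id t).smul_const (e3 i)).add_const a
    exact (((hu.differentiable (by simp)) _).hasFDerivAt.comp_hasDerivAt t h1).norm_sq
  have hcs2 : ∀ (i : Fin 3) (x : E3), (2 * inner ℝ (u x) (pd i u x)) ^ 2 ≤
      4 * ‖u x‖ ^ 2 * ‖pd i u x‖ ^ 2 := fun i x => by
    have := sq_le_sq' (neg_le_of_abs_le (abs_real_inner_le_norm (u x) (pd i u x)))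
      (le_of_abs_le (abs_real_inner_le_norm (u x) (pd i u x)))
    linarith
  have hb : ∀ {x y z : ℝ}, (R ≤ |x| ∨ R ≤ |y| ∨ R ≤ |z|) → ‖u (pt x y z)‖ ^ 2 = 0 :=
    fun {x y z} h => by
      obtain ⟨h1, h2, h3⟩ := abs_coord_le_norm_pt x y z
      rw [hu0 _ (by rcases h with h | h | h <;> linarith)]
      simp
  have hRR : R ≤ |R| := le_abs_self R
  have hRR' : R ≤ |-R| := by rwa [abs_neg]
  have hqc := ((huc.comp continuous_pt).norm.pow 2)
  have hq' : ∀ i, Continuous fun w : ℝ × ℝ × ℝ =>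
      2 * inner ℝ (u (pt w.1 w.2.1 w.2.2)) (pd i u (pt w.1 w.2.1 w.2.2)) := fun i =>
    continuous_const.mul ((huc.comp continuous_pt).inner ((hpdc i).comp continuous_pt))
  have hNc := fun i => (((hpdc i).comp continuous_pt).norm.pow 2)
  have key := sobolev_cube hR (q := fun x y z => ‖u (pt x y z)‖ ^ 2)
    (q₁ := fun x y z => 2 * inner ℝ (u (pt x y z)) (pd 0 u (pt x y z)))
    (q₂ := fun x y z => 2 * inner ℝ (u (pt x y z)) (pd 1 u (pt x y z)))
    (q₃ := fun x y z => 2 * inner ℝ (u (pt x y z)) (pd 2 u (pt x y z)))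
    (N₁ := fun x y z => ‖pd 0 u (pt x y z)‖ ^ 2) (N₂ := fun x y z => ‖pd 1 u (pt x y z)‖ ^ 2)
    (N₃ := fun x y z => ‖pd 2 u (pt x y z)‖ ^ 2)
    hqc (hq' 0) (hq' 1) (hq' 2) (hNc 0) (hNc 1) (hNc 2)
    (fun _ _ _ => sq_nonneg _) (fun _ _ _ => sq_nonneg _) (fun _ _ _ => sq_nonneg _)
    (fun _ _ _ => sq_nonneg _)
    (fun x y z => by
      have e : ∀ x, pt x y z = x • e3 0 + (y • e3 1 + z • e3 2) := fun x => by
        simp only [pt]; abel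
      simp only [e]; exact hd 0 x _)
    (fun x y z => by
      have e : ∀ y, pt x y z = y • e3 1 + (x • e3 0 + z • e3 2) := fun y => by
        simp only [pt]; abel
      simp only [e]; exact hd 1 y _)
    (fun x y z => by
      have e : ∀ z, pt x y z = z • e3 2 + (x • e3 0 + y • e3 1) := fun z => by
        simp only [pt]; abel
      simp only [e]; exact hd 2 z _)
    (fun _ _ => hb (.inl hRR')) (fun _ _ => hb (.inl hRR))
    (fun _ _ => hb (.inr (.inl hRR'))) (fun _ _ => hb (.inr (.inl hRR)))
    (fun _ _ => hb (.inr (.inr hRR'))) (fun _ _ => hb (.inr (.inr hRR)))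
    (fun _ _ _ => hcs2 0 _) (fun _ _ _ => hcs2 1 _) (fun _ _ _ => hcs2 2 _)
  have hNi : ∀ i, ∫ x, ‖pd i u x‖ ^ 2 =
      ∫ x in (-R)..R, ∫ y in (-R)..R, ∫ z in (-R)..R, ‖pd i u (pt x y z)‖ ^ 2 := fun i =>
    integral_E3 ((hpdc i).norm.pow 2) fun x hx => by simp [hpd0 i x hx]
  have hint : ∀ i, Integrable fun x => ‖pd i u x‖ ^ 2 := fun i =>
    ((hpdc i).norm.pow 2).integrable_of_hasCompactSupport
      (HasCompactSupport.of_support_subset_isCompact (isCompact_closedBall 0 R) fun x hx => by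
        rw [mem_closedBall_zero_iff]
        by_contra! h
        exact hx (by simp [hpd0 i x h.le]))
  have hgrad : ∫ x, gradSqV u x = (∫ x, ‖pd 0 u x‖ ^ 2) + (∫ x, ‖pd 1 u x‖ ^ 2) +
      ∫ x, ‖pd 2 u x‖ ^ 2 := by
    have h01 : Integrable fun x => ‖pd 0 u x‖ ^ 2 + ‖pd 1 u x‖ ^ 2 := (hint 0).add (hint 1)
    rw [← integral_add (hint 0) (hint 1), ← integral_add h01 (hint 2)]
    refine integral_congr_ae (Filter.Eventually.of_forall fun x => ?_)
    simp only [gradSqV, EuclideanSpace.real_norm_sq_eq, Fin.sum_univ_three]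
  have hsix : ∫ x, ‖u x‖ ^ 6 =
      ∫ x in (-R)..R, ∫ y in (-R)..R, ∫ z in (-R)..R, (‖u (pt x y z)‖ ^ 2) ^ 3 := by
    rw [integral_E3 (g := fun x => ‖u x‖ ^ 6) (R := R) (huc.norm.pow 6)
      fun x hx => by simp [hu0 x hx]]
    simp only [← pow_mul, Nat.reduceMul]
  rw [hgrad, hsix, hNi, hNi, hNi]
  exact key

/-- **Sharp Sobolev inequality in ℝ³ (Talenti).** For every smooth compactly supported
`u : ℝ³ → ℝ³`, `‖u‖_{L⁶} ≤ 2^{2/3} 3^{-1/2} π^{-2/3} ‖∇u‖_{L²}`; equivalently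
`‖u‖_{L⁶}^{3/2} ≤ (2/(3^{3/4} π)) ‖∇u‖_{L²}^{3/2}`. -/
theorem stmt_9 (u : E3 → E3) (hu : ContDiff ℝ (⊤ : ℕ∞) u) (hcs : HasCompactSupport u) :
    (∫ x : E3, ‖u x‖ ^ 6) ^ ((1 : ℝ) / 6) ≤
      (2 : ℝ) ^ ((2 : ℝ) / 3) * (3 : ℝ) ^ (-(1 : ℝ) / 2) * π ^ (-(2 : ℝ) / 3) *
        (∫ x : E3, gradSqV u x) ^ ((1 : ℝ) / 2) ∧
    ((∫ x : E3, ‖u x‖ ^ 6) ^ ((1 : ℝ) / 6)) ^ ((3 : ℝ) / 2) ≤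
      (2 / ((3 : ℝ) ^ ((3 : ℝ) / 4) * π)) *
        ((∫ x : E3, gradSqV u x) ^ ((1 : ℝ) / 2)) ^ ((3 : ℝ) / 2) := by
  have key := sobolev_integral u hu hcs
  have hI : 0 ≤ ∫ x : E3, ‖u x‖ ^ 6 := integral_nonneg fun x => by positivity
  have hD : 0 ≤ ∫ x : E3, gradSqV u x := integral_nonneg fun x => by
    simp only [gradSqV, Pi.zero_apply]; positivity
  generalize (∫ x : E3, ‖u x‖ ^ 6) = I at *
  generalize (∫ x : E3, gradSqV u x) = D at *
  have hπ := Real.pi_pos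
  have h1 : I ^ ((1 : ℝ) / 6) ≤
      (2 : ℝ) ^ ((2 : ℝ) / 3) * (3 : ℝ) ^ (-(1 : ℝ) / 2) * π ^ (-(2 : ℝ) / 3) *
        D ^ ((1 : ℝ) / 2) := by
    refine le_of_pow_le_pow_left₀ (n := 6) (by norm_num) (by positivity) ?_
    simp only [mul_pow, ← Real.rpow_mul_natCast hI, ← Real.rpow_mul_natCast hD,
      ← Real.rpow_mul_natCast hπ.le, ← Real.rpow_mul_natCast zero_le_two,
      ← Real.rpow_mul_natCast zero_le_three]
    have h_e2 : (2 : ℝ) ^ ((2 : ℝ) / 3 * (6 : ℕ)) = 16 := by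
      rw [show (2 : ℝ) / 3 * (6 : ℕ) = (4 : ℕ) by norm_num, Real.rpow_natCast]; norm_num
    have h_e3 : (3 : ℝ) ^ (-(1 : ℝ) / 2 * (6 : ℕ)) = 1 / 27 := by
      rw [show -(1 : ℝ) / 2 * (6 : ℕ) = -(3 : ℕ) by norm_num, Real.rpow_neg zero_le_three,
        Real.rpow_natCast]; norm_num
    have h_e4 : π ^ (-(2 : ℝ) / 3 * (6 : ℕ)) = (π ^ 4)⁻¹ := by
      rw [show -(2 : ℝ) / 3 * (6 : ℕ) = -(4 : ℕ) by norm_num, Real.rpow_neg hπ.le,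
        Real.rpow_natCast]
    have h_e5 : D ^ ((1 : ℝ) / 2 * (6 : ℕ)) = D ^ 3 := by
      rw [show (1 : ℝ) / 2 * (6 : ℕ) = (3 : ℕ) by norm_num, Real.rpow_natCast]
    have h_e6 : I ^ ((1 : ℝ) / 6 * (6 : ℕ)) = I := by norm_num
    rw [h_e2, h_e3, h_e4, h_e5, h_e6]
    have : 16 * (1 / 27) * (π ^ 4)⁻¹ * D ^ 3 = (16 * D ^ 3) / (27 * π ^ 4) := by field_simp
    rw [this, le_div_iff₀ (by positivity)]
    linarith
  refine ⟨h1, (Real.rpow_le_rpow (by positivity) h1 (by norm_num)).trans_eq ?_⟩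
  rw [Real.mul_rpow (by positivity) (by positivity), Real.mul_rpow (by positivity) (by positivity),
    Real.mul_rpow (by positivity) (by positivity)]
  congr 1
  rw [← Real.rpow_mul zero_le_two, ← Real.rpow_mul zero_le_three, ← Real.rpow_mul hπ.le,
    show (2 : ℝ) / 3 * (3 / 2) = 1 by norm_num, show -(1 : ℝ) / 2 * (3 / 2) = -(3 / 4) by norm_num,
    show -(2 : ℝ) / 3 * (3 / 2) = -1 by norm_num, Real.rpow_neg zero_le_three,
    Real.rpow_neg hπ.le, Real.rpow_one, Real.rpow_one]
  field_simp
end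
end

section
/- Let c > 0 and let g : (0,∞) → [0,∞) be measurable with ∫_σ^∞ g(τ) e^{−c(τ−σ)} dτ → 0 as σ → ∞. Then there exists a measurable set G ⊂ (0,∞) such that m₁(G ∩ (σ,∞)) > 0 for every σ > 0 (where m₁ is the 1-dimensional Lebesgue measure), and g(t) → 0 as t → ∞ along G, i.e. for every ε > 0 there exists σ > 0 such that g(t) < ε for all t ∈ G with t > σ. -/
open MeasureTheory Set

lemma integrableOn_exp_neg_mul_sub_Ioi {c : ℝ} (hc : 0 < c) (s : ℝ) :
    IntegrableOn (fun τ => Real.exp (-c * (τ - s))) (Ioi s) := by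
  have h := (integrableOn_exp_mul_Ioi (neg_lt_zero.mpr hc) s).mul_const (Real.exp (c * s))
  refine h.congr (ae_of_all _ fun τ => ?_)
  simp only [← Real.exp_add]
  ring_nf

lemma integral_exp_neg_mul_sub_Ioi {c : ℝ} (hc : 0 < c) (s : ℝ) :
    ∫ τ in Ioi s, Real.exp (-c * (τ - s)) = 1 / c := by
  have h : ∀ τ, Real.exp (-c * (τ - s)) = Real.exp (-c * τ) * Real.exp (c * s) := fun τ => by
    rw [← Real.exp_add]
    ring_nf
  simp_rw [h]
  rw [integral_mul_const, integral_exp_mul_Ioi (neg_lt_zero.mpr hc), neg_div_neg_eq,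
    div_mul_eq_mul_div, ← Real.exp_add]
  simp

/-- If the exponentially weighted tail integrals of `g` tend to `0`, then the sublevel sets
`{g < ε}` have positive measure arbitrarily far out. -/
lemma volume_sublevel_inter_Ioi_pos {c : ℝ} (hc : 0 < c) {g : ℝ → ℝ} (hg_meas : Measurable g)
    (hg_int : ∀ σ > (0 : ℝ),
      IntegrableOn (fun τ => g τ * Real.exp (-c * (τ - σ))) (Ioi σ))
    (hg_tail : Filter.Tendsto (fun σ : ℝ => ∫ τ in Ioi σ, g τ * Real.exp (-c * (τ - σ)))
      Filter.atTop (nhds 0)) {ε : ℝ} (hε : 0 < ε) (σ : ℝ) :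
    0 < volume ({t | g t < ε} ∩ Ioi σ) := by
  by_contra! hnull
  have hmeas : MeasurableSet {t | g t < ε} := measurableSet_lt hg_meas measurable_const
  have hge : ∀ᵐ t ∂volume.restrict (Ioi σ), ε ≤ g t := by
    rw [ae_iff]
    simp only [not_le]
    rw [Measure.restrict_apply hmeas]
    exact le_antisymm hnull zero_le
  obtain ⟨s, hs, hσs, hs0⟩ := ((hg_tail.eventually_lt_const (div_pos hε hc)).and
    ((Filter.eventually_ge_atTop σ).and (Filter.eventually_gt_atTop 0))).exists
  refine hs.not_ge ?_
  calc ε / c = ∫ τ in Ioi s, ε * Real.exp (-c * (τ - s)) := by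
        rw [integral_const_mul, integral_exp_neg_mul_sub_Ioi hc, mul_one_div]
    _ ≤ ∫ τ in Ioi s, g τ * Real.exp (-c * (τ - s)) := by
        refine integral_mono_ae ((integrableOn_exp_neg_mul_sub_Ioi hc s).const_mul ε)
          (hg_int s hs0) ?_
        filter_upwards [ae_restrict_of_ae_restrict_of_subset (Ioi_subset_Ioi hσs) hge] with τ hτ
        gcongr

lemma exists_volume_inter_Ioc_pos {s : Set ℝ} {σ : ℝ} (h : 0 < volume (s ∩ Ioi σ)) :
    ∃ a, 0 < volume (s ∩ Ioc σ a) := by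
  by_contra! hnull
  refine h.ne' (measure_mono_null (t := ⋃ k : ℕ, s ∩ Ioc σ k) ?_
    (measure_iUnion_null fun k => le_antisymm (hnull k) zero_le))
  rintro t ⟨hts, hσt⟩
  obtain ⟨k, hk⟩ := exists_nat_ge t
  exact mem_iUnion.mpr ⟨k, hts, hσt, hk⟩

/-- If `g ≥ 0` is measurable on `(0,∞)`, its weighted tail integrals
`∫_σ^∞ g(τ) e^{-c(τ-σ)} dτ` are finite and tend to `0` as `σ → ∞`, then there is a
measurable set `G ⊆ (0,∞)` with `m₁(G ∩ (σ,∞)) > 0` for every `σ > 0` along which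
`g` tends to `0` at infinity. -/
theorem stmt_13 (c : ℝ) (hc : 0 < c) (g : ℝ → ℝ) (hg_meas : Measurable g)
    (hg_nonneg : ∀ t ∈ Ioi (0 : ℝ), 0 ≤ g t)
    (hg_int : ∀ σ > (0 : ℝ),
      IntegrableOn (fun τ => g τ * Real.exp (-c * (τ - σ))) (Ioi σ))
    (hg_tail : Filter.Tendsto (fun σ : ℝ => ∫ τ in Ioi σ, g τ * Real.exp (-c * (τ - σ)))
      Filter.atTop (nhds 0)) :
    ∃ G : Set ℝ, G ⊆ Ioi 0 ∧ MeasurableSet G ∧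
      (∀ σ > (0 : ℝ), 0 < volume (G ∩ Ioi σ)) ∧
      (∀ ε > (0 : ℝ), ∃ σ > (0 : ℝ), ∀ t ∈ G, σ < t → g t < ε) := by
  choose a ha using fun n : ℕ => exists_volume_inter_Ioc_pos
    (volume_sublevel_inter_Ioi_pos hc hg_meas hg_int hg_tail (Nat.one_div_pos_of_nat (n := n)) n)
  refine ⟨⋃ n : ℕ, {t | g t < 1 / ((n : ℝ) + 1)} ∩ Ioc (n : ℝ) (a n), ?_, ?_, ?_, ?_⟩
  · exact iUnion_subset fun n t ht => (Nat.cast_nonneg n).trans_lt ht.2.1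
  · exact .iUnion fun n => (measurableSet_lt hg_meas measurable_const).inter measurableSet_Ioc
  · intro σ _
    obtain ⟨n, hn⟩ := exists_nat_ge σ
    refine (ha n).trans_le (measure_mono fun t ht => ⟨mem_iUnion.mpr ⟨n, ht⟩, ?_⟩)
    exact hn.trans_lt ht.2.1
  · intro ε hε
    obtain ⟨N, hN⟩ := exists_nat_one_div_lt hε
    obtain ⟨M, hM⟩ := ((Finset.range N).image a).bddAbove
    refine ⟨max M 1, by positivity, fun t ht hlt => ?_⟩
    obtain ⟨n, hgt, -, hta⟩ := mem_iUnion.mp ht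
    have hNn : N ≤ n := by
      by_contra! hnN
      have : a n ≤ M := hM (by simpa using ⟨n, hnN, rfl⟩)
      linarith [le_max_left M 1]
    exact (lt_of_lt_of_le hgt (Nat.one_div_le_one_div hNn)).trans hN
end
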